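/- arXiv:1302.0982 — 3 statements merged into one kernel-verified Lean document; each statement's English description precedes it below -/
import Mathlib

section
/- For all integers α, β, γ, δ ≥ 1, the monoid M = Mon⟨a,b : a^α b^β a^γ b^δ = b⟩ admits a finite complete rewriting system: there exists a finite alphabet A containing {a,b}, and a finite set R ⊆ A* × A* of rewriting rules, such that the one-step rewriting relation → determined by R (where x → y iff x = u·l·v and y = u·r·v for some rule (l,r) ∈ R and words u,v) is confluent and terminating, and the monoid presented by the generators A with the defining relations {l = r : (l,r) ∈ R} is isomorphic to M. -/
open Relation FreeMonoid

/-- Words over the alphabet `A`: the free monoid on `A`. -/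
abbrev Word (A : Type) : Type := FreeMonoid A

/-- One-step rewriting relation of the rewriting system `R`. -/
def OneStep {A : Type} (R : Set (Word A × Word A)) (x y : Word A) : Prop :=
  ∃ u v l r : Word A, (l, r) ∈ R ∧ x = u * l * v ∧ y = u * r * v

/-- Confluence of the rewriting system `R`. -/
def IsConfluent {A : Type} (R : Set (Word A × Word A)) : Prop :=
  ∀ w x y : Word A, ReflTransGen (OneStep R) w x → ReflTransGen (OneStep R) w y →
    ∃ z : Word A, ReflTransGen (OneStep R) x z ∧ ReflTransGen (OneStep R) y z

/-- Termination of the rewriting system `R`: no infinite rewriting chain. -/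
def IsTerminating {A : Type} (R : Set (Word A × Word A)) : Prop :=
  ¬ ∃ f : ℕ → Word A, ∀ n : ℕ, OneStep R (f n) (f (n + 1))

/-- The monoid presented by generators `A` and relations `R`: the quotient of the
free monoid on `A` by the congruence generated by `R`. -/
abbrev MonPres {A : Type} (R : Set (Word A × Word A)) : Type :=
  (conGen fun x y : Word A => (x, y) ∈ R).Quotient

/-- The canonical projection from words to the presented monoid. -/
def presMk {A : Type} (R : Set (Word A × Word A)) : Word A →* MonPres R :=
  Con.mk' _

/-- A two-letter alphabet. -/
inductive AB : Type | a | b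

/-- A three-letter alphabet. -/
inductive ABX : Type | a | b | x

section General

variable {A B : Type} {R : Set (Word A × Word A)} {S : Set (Word B × Word B)}

theorem IsTerminating.wellFounded (h : IsTerminating R) :
    WellFounded fun y x => OneStep R x y := by
  rw [wellFounded_iff_isEmpty_descending_chain]
  exact ⟨fun f => h ⟨f.1, f.2⟩⟩

theorem OneStep.context {x y : Word A} (h : OneStep R x y) (p s : Word A) :
    OneStep R (p * x * s) (p * y * s) := by
  obtain ⟨u, v, l, r, hlr, rfl, rfl⟩ := h
  exact ⟨p * u, v * s, l, r, hlr, by simp only [mul_assoc], by simp only [mul_assoc]⟩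

theorem reduces_context {x y : Word A} (h : ReflTransGen (OneStep R) x y) (p s : Word A) :
    ReflTransGen (OneStep R) (p * x * s) (p * y * s) :=
  h.lift (fun w => p * w * s) fun _ _ h => h.context p s

theorem reduces_of_mem {l r x y : Word A} (h : (l, r) ∈ R) (p s : Word A)
    (hx : x = p * (l * s)) (hy : y = p * (r * s)) : ReflTransGen (OneStep R) x y :=
  .single ⟨p, s, l, r, h, by rw [hx, mul_assoc], by rw [hy, mul_assoc]⟩

theorem FreeMonoid.mul_eq_mul_iff {a b c d : Word A} :
    a * b = c * d ↔ (∃ e, c = a * e ∧ b = e * d) ∨ ∃ e, a = c * e ∧ d = e * b :=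
  List.append_eq_append_iff

/-- Critical pair criterion for local confluence: an occurrence of a second left-hand side starting
at offset `p` only matters when `p` does not contain the first left-hand side. -/
theorem locally_confluent_of_overlaps
    (H : ∀ l₁ r₁ l₂ r₂, (l₁, r₁) ∈ R → (l₂, r₂) ∈ R → ∀ p t s : Word A, l₁ * t = p * (l₂ * s) →
      (∀ q, p ≠ l₁ * q) → Join (ReflTransGen (OneStep R)) (r₁ * t) (p * (r₂ * s)))
    {w x y : Word A} (hx : OneStep R w x) (hy : OneStep R w y) :
    Join (ReflTransGen (OneStep R)) x y := by
  have key : ∀ l₁ r₁ l₂ r₂, (l₁, r₁) ∈ R → (l₂, r₂) ∈ R → ∀ u p t s : Word A,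
      l₁ * t = p * (l₂ * s) →
      Join (ReflTransGen (OneStep R)) (u * r₁ * t) (u * p * r₂ * s) := by
    intro l₁ r₁ l₂ r₂ h₁ h₂ u p t s h
    by_cases hp : ∃ q, p = l₁ * q
    · obtain ⟨q, rfl⟩ := hp
      rw [mul_assoc] at h
      obtain rfl := mul_left_cancel h
      exact ⟨u * r₁ * q * r₂ * s,
        reduces_of_mem h₂ (u * r₁ * q) s (by simp only [mul_assoc]) (by simp only [mul_assoc]),
        reduces_of_mem h₁ u (q * r₂ * s) (by simp only [mul_assoc]) (by simp only [mul_assoc])⟩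
    · obtain ⟨z, h1, h2⟩ := H l₁ r₁ l₂ r₂ h₁ h₂ p t s h (not_exists.mp hp)
      exact ⟨u * z, by simpa [mul_assoc] using reduces_context h1 u 1,
        by simpa [mul_assoc] using reduces_context h2 u 1⟩
  obtain ⟨u₁, v₁, l₁, r₁, h₁, rfl, rfl⟩ := hx
  obtain ⟨u₂, v₂, l₂, r₂, h₂, h, rfl⟩ := hy
  rw [mul_assoc, mul_assoc, FreeMonoid.mul_eq_mul_iff] at h
  obtain ⟨p, rfl, h⟩ | ⟨p, rfl, h⟩ := h
  · exact key l₁ r₁ l₂ r₂ h₁ h₂ u₁ p v₁ v₂ h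
  · obtain ⟨z, h1, h2⟩ := key l₂ r₂ l₁ r₁ h₂ h₁ u₂ p v₂ v₁ h
    exact ⟨z, h2, h1⟩

/-- Newman's lemma. -/
theorem IsTerminating.isConfluent (hT : IsTerminating R)
    (hL : ∀ w x y, OneStep R w x → OneStep R w y → Join (ReflTransGen (OneStep R)) x y) :
    IsConfluent R := by
  intro w
  induction w using hT.wellFounded.induction with
  | _ w ih =>
    intro x y hx hy
    obtain rfl | ⟨x', hwx, hx'⟩ := hx.cases_head
    · exact ⟨y, hy, .refl⟩
    obtain rfl | ⟨y', hwy, hy'⟩ := hy.cases_head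
    · exact ⟨x, .refl, hx⟩
    obtain ⟨z, hxz, hyz⟩ := hL w x' y' hwx hwy
    obtain ⟨v, hxv, hzv⟩ := ih x' hwx x z hx' hxz
    obtain ⟨t, hvt, hyt⟩ := ih y' hwy v y (hyz.trans hzv) hy'
    exact ⟨t, hxv.trans hvt, hyt⟩

/-- The total weight of a word. -/
def wordWeight (wt : A → ℕ) (w : Word A) : ℕ := (w.toList.map wt).sum

variable (wt : A → ℕ)

theorem wordWeight_one : wordWeight wt 1 = 0 := rfl

theorem wordWeight_mul (x y : Word A) :
    wordWeight wt (x * y) = wordWeight wt x + wordWeight wt y := by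
  simp [wordWeight]

theorem wordWeight_of (x : A) : wordWeight wt (of x) = wt x := by simp [wordWeight]

theorem wordWeight_pow (x : Word A) (n : ℕ) : wordWeight wt (x ^ n) = n * wordWeight wt x := by
  induction n with
  | zero => simp [wordWeight_one]
  | succ n ih => rw [pow_succ, wordWeight_mul, ih, Nat.succ_mul]

/-- A rewriting system terminates if each rule lowers the weight, or keeps the weight and lowers the
rank of the first letter. -/
theorem isTerminating_of_weight [Finite A] (rk : A → ℕ) (hwt : ∀ x, 1 ≤ wt x)
    (h : ∀ l r, (l, r) ∈ R → wordWeight wt r < wordWeight wt l ∨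
      (wordWeight wt r = wordWeight wt l ∧
        ∃ x y l' r', l = of x * l' ∧ r = of y * r' ∧ rk y < rk x)) :
    IsTerminating R := by
  rintro ⟨f, hf⟩
  have step : ∀ x y, OneStep R x y → wordWeight wt y < wordWeight wt x ∨
      (wordWeight wt y = wordWeight wt x ∧ y.toList.map rk < x.toList.map rk) := by
    rintro _ _ ⟨u, v, l, r, hlr, rfl, rfl⟩
    simp only [wordWeight_mul]
    obtain h | ⟨h, a, b, l', r', rfl, rfl, hab⟩ := h l r hlr
    · left; omega
    · refine .inr ⟨by omega, ?_⟩
      simp only [toList_mul, toList_of, List.map_append, List.append_assoc, List.map_cons,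
        List.cons_append, List.nil_append]
      exact List.append_left_lt (List.cons_lt_cons_iff.mpr (.inl hab))
  obtain ⟨n, hn⟩ : ∃ n, ∀ k, wordWeight wt (f n) ≤ wordWeight wt (f k) := by
    obtain ⟨_, ⟨n, rfl⟩, hn⟩ := wellFounded_lt.has_min (Set.range fun n => wordWeight wt (f n))
      ⟨_, 0, rfl⟩
    exact ⟨n, fun k => not_lt.mp (hn _ ⟨k, rfl⟩)⟩
  have hc : ∀ k, wordWeight wt (f (n + k)) = wordWeight wt (f n) := by
    intro k
    induction k with
    | zero => rfl
    | succ k ih =>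
      have := hn (n + (k + 1))
      obtain h | h := step _ _ (hf (n + k))
      · rw [← add_assoc] at this ⊢; omega
      · rw [← add_assoc]; omega
  have ha : StrictAnti fun k => (f (n + k)).toList.map rk := by
    refine strictAnti_nat_of_succ_lt fun k => ?_
    obtain h | h := step _ _ (hf (n + k))
    · have := hc k
      have := hc (k + 1)
      rw [← add_assoc] at this
      omega
    · exact h.2
  have hi : Function.Injective fun k => (f (n + k)).toList := fun i j hij =>
    ha.injective (congrArg (List.map rk) hij)
  refine Set.infinite_of_injective_forall_mem hi (s := {l | l.length ≤ wordWeight wt (f n)})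
    (fun k => ?_) (List.finite_length_le A _)
  rw [Set.mem_ofPred_eq, ← hc k, wordWeight]
  simpa using List.length_le_sum_of_one_le ((f (n + k)).toList.map wt) (by simpa using fun x _ => hwt x)

theorem presMk_eq_of_mem {l r : Word A} (h : (l, r) ∈ R) : presMk R l = presMk R r :=
  (Con.eq _).mpr (.of _ _ h)

/-- The homomorphism out of a presented monoid determined by images of the generators. -/
def presLift {M : Type} [Monoid M] (f : Word A →* M) (hf : ∀ l r, (l, r) ∈ R → f l = f r) :
    MonPres R →* M :=
  Con.lift _ f (Con.conGen_le.mpr hf)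

theorem presLift_presMk {M : Type} [Monoid M] (f : Word A →* M)
    (hf : ∀ l r, (l, r) ∈ R → f l = f r) (w : Word A) : presLift f hf (presMk R w) = f w := rfl

theorem MonPres.hom_ext {M : Type} [Monoid M] {f g : MonPres R →* M}
    (h : ∀ x, f (presMk R (of x)) = g (presMk R (of x))) : f = g :=
  Con.lift_funext _ _ <| DFunLike.congr_fun <|
    FreeMonoid.hom_eq (f := f.comp (presMk R)) (g := g.comp (presMk R)) h

/-- Mutually inverse substitutions identify two presented monoids. -/
theorem nonempty_presEquiv (f : A → Word B) (g : B → Word A)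
    (hf : ∀ l r, (l, r) ∈ R → presMk S (lift f l) = presMk S (lift f r))
    (hg : ∀ l r, (l, r) ∈ S → presMk R (lift g l) = presMk R (lift g r))
    (hgf : ∀ x, presMk R (lift g (f x)) = presMk R (of x))
    (hfg : ∀ x, presMk S (lift f (g x)) = presMk S (of x)) :
    Nonempty (MonPres R ≃* MonPres S) :=
  ⟨MonoidHom.toMulEquiv (presLift ((presMk S).comp (lift f)) hf)
    (presLift ((presMk R).comp (lift g)) hg)
    (MonPres.hom_ext fun x => by simpa [presLift_presMk] using hgf x)
    (MonPres.hom_ext fun x => by simpa [presLift_presMk] using hfg x)⟩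

end General

section Words

variable {A : Type} {a b c h x y z : A} {p q s t w W : Word A} {i j k n B : ℕ}

theorem of_mul_eq_of_mul_iff : of x * s = of y * t ↔ x = y ∧ s = t := by
  rw [← toList.apply_eq_iff_eq, toList_of_mul, toList_of_mul, List.cons.injEq]
  rfl

theorem of_mul_eq_mul (e : of x * w = p * q) :
    (p = 1 ∧ q = of x * w) ∨ ∃ p', p = of x * p' ∧ w = p' * q := by
  induction p using FreeMonoid.casesOn with
  | one => exact .inl ⟨rfl, by rw [e, one_mul]⟩
  | of_mul y p' =>
    rw [mul_assoc, of_mul_eq_of_mul_iff] at e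
    obtain ⟨rfl, rfl⟩ := e
    exact .inr ⟨p', rfl, rfl⟩

theorem pow_of_mul_eq_pow_of_mul (hx : x ≠ b) (e : of b ^ i * (of x * s) = of b ^ j * t) :
    ∃ n, i = j + n ∧ t = of b ^ n * (of x * s) := by
  induction j generalizing i with
  | zero => exact ⟨i, by omega, by simpa using e.symm⟩
  | succ j ih =>
    cases i with
    | zero =>
      rw [pow_zero, one_mul, pow_succ', mul_assoc, of_mul_eq_of_mul_iff] at e
      exact absurd e.1 hx
    | succ i =>
      rw [pow_succ', pow_succ', mul_assoc, mul_assoc, mul_right_inj] at e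
      obtain ⟨n, rfl, rfl⟩ := ih e
      exact ⟨n, by omega, rfl⟩

theorem pow_of_mul_of_mul_inj (hx : x ≠ b) (hy : y ≠ b)
    (e : of b ^ i * (of x * s) = of b ^ j * (of y * t)) : i = j ∧ x = y ∧ s = t := by
  obtain ⟨n, rfl, h⟩ := pow_of_mul_eq_pow_of_mul hx e
  obtain ⟨n', h', h''⟩ := pow_of_mul_eq_pow_of_mul hy e.symm
  obtain rfl : n = 0 := by omega
  obtain ⟨rfl, rfl⟩ : y = x ∧ t = s := by simpa [of_mul_eq_of_mul_iff] using h
  exact ⟨by omega, rfl, rfl⟩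

/-- Two occurrences of blocks `a ^ n`, `a ^ k` followed by other letters: either the blocks end at
the same place or the second one starts after the first. -/
theorem pow_of_mul_eq_mul_pow_of_mul (hc : c ≠ a) (hh : h ≠ a)
    (e : of a ^ n * (of c * w) = p * (of a ^ k * (of h * q))) :
    (∃ i, p = of a ^ i ∧ i + k = n ∧ c = h ∧ w = q) ∨
      ∃ p', p = of a ^ n * (of c * p') ∧ w = p' * (of a ^ k * (of h * q)) := by
  induction n generalizing p with
  | zero =>
    obtain ⟨rfl, e'⟩ | ⟨p', rfl, e'⟩ := of_mul_eq_mul (by simpa using e)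
    · obtain ⟨rfl, rfl, rfl⟩ := pow_of_mul_of_mul_inj hh hc (j := 0) (by simpa using e')
      exact .inl ⟨0, rfl, rfl, rfl, rfl⟩
    · exact .inr ⟨p', by simp, e'⟩
  | succ n ih =>
    rw [pow_succ', mul_assoc] at e
    obtain ⟨rfl, e'⟩ | ⟨p', rfl, e'⟩ := of_mul_eq_mul e
    · rw [← mul_assoc (of a), ← pow_succ'] at e'
      obtain ⟨rfl, rfl, rfl⟩ := pow_of_mul_of_mul_inj hh hc e'
      exact .inl ⟨0, rfl, by omega, rfl, rfl⟩
    · obtain ⟨i, rfl, rfl, rfl, rfl⟩ | ⟨p'', rfl, rfl⟩ := ih e'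
      · exact .inl ⟨i + 1, by rw [pow_succ'], by omega, rfl, rfl⟩
      · exact .inr ⟨p'', by rw [pow_succ', mul_assoc], rfl⟩

theorem notMem_pow (h : x ∉ w) (n : ℕ) : x ∉ w ^ n := by
  induction n with
  | zero => exact notMem_one
  | succ n ih => rw [pow_succ, mem_mul]; tauto

theorem exists_eq_mul_of_notMem (ha : x ∉ W) (e : W * t = p * (of x * q)) :
    ∃ p', p = W * p' ∧ t = p' * (of x * q) := by
  obtain ⟨r, rfl, h⟩ | ⟨r, rfl, h⟩ := FreeMonoid.mul_eq_mul_iff.mp e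
  · exact ⟨r, rfl, h⟩
  · obtain ⟨rfl, -⟩ | ⟨r', rfl, -⟩ := of_mul_eq_mul h
    · exact ⟨1, by simp, by simpa using h.symm⟩
    · simp [mem_mul, mem_of] at ha

/-- The word `b ^ i z b ^ j`. -/
def block (b z : A) (i j : ℕ) : Word A := of b ^ i * (of z * of b ^ j)

theorem notMem_block (hb : c ≠ b) (hz : c ≠ z) : c ∉ block b z i j := by
  have : c ∉ of b := by simpa [mem_of] using hb
  simp [block, mem_mul, mem_of, hz, notMem_pow this]

theorem pow_block_mul_eq_mul (hz : z ≠ b)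
    (e : block b z B k ^ n * w = p * (of z * q)) :
    (∃ i j, i + j + 1 = n ∧ p = block b z B k ^ i * of b ^ B ∧
        q = of b ^ k * (block b z B k ^ j * w)) ∨
      ∃ p', p = block b z B k ^ n * p' ∧ w = p' * (of z * q) := by
  have hb (m : ℕ) : z ∉ of b ^ m := notMem_pow (by simpa [mem_of] using hz) m
  induction n generalizing p with
  | zero => exact .inr ⟨p, by simp, by simpa using e⟩
  | succ n ih =>
    rw [pow_succ', mul_assoc, block, mul_assoc, mul_assoc, ← block] at e
    obtain ⟨p₁, rfl, e₁⟩ := exists_eq_mul_of_notMem (hb B) e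
    obtain ⟨rfl, e₂⟩ | ⟨p₂, rfl, e₂⟩ := of_mul_eq_mul e₁
    · exact .inl ⟨0, n, by omega, by simp, (of_mul_eq_of_mul_iff.mp e₂).2⟩
    · obtain ⟨p₃, rfl, e₃⟩ := exists_eq_mul_of_notMem (hb k) e₂
      obtain ⟨i, j, rfl, rfl, rfl⟩ | ⟨p', rfl, rfl⟩ := ih e₃
      · exact .inl ⟨i + 1, j, by omega, by rw [pow_succ']; nth_rw 2 [block]; simp only [mul_assoc], rfl⟩
      · exact .inr ⟨p', by rw [pow_succ']; nth_rw 2 [block]; simp only [mul_assoc], rfl⟩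

end Words

section NotDvd

variable {A : Type} {a b z : A} {u : Word A} {r s m : ℕ}

/-- The rules used when `γ = (r + s) * m + r` and `α = r + s` with `r, s ≠ 0`. -/
def notDvdRules (a b z : A) (u : Word A) (r s m : ℕ) : Set (Word A × Word A) :=
  {(of a ^ (r + s) * (of z * u), of z), (of a ^ r * of b, of z * u ^ m),
    (of a ^ s * (of z * u ^ (m + 1)), of b)}

theorem notDvdRules_overlap (hr : 1 ≤ r) (hs : 1 ≤ s) (hab : b ≠ a) (haz : z ≠ a) (hbz : b ≠ z)
    (hu : a ∉ u) {l₁ r₁ l₂ r₂ : Word A} (h₁ : (l₁, r₁) ∈ notDvdRules a b z u r s m)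
    (h₂ : (l₂, r₂) ∈ notDvdRules a b z u r s m) {p t v : Word A} (e : l₁ * t = p * (l₂ * v))
    (hp : ∀ q, p ≠ l₁ * q) :
    Join (ReflTransGen (OneStep (notDvdRules a b z u r s m))) (r₁ * t) (p * (r₂ * v)) := by
  have form : ∀ l r', (l, r') ∈ notDvdRules a b z u r s m → ∃ k c W, l = of a ^ (k + 1) * (of c * W) ∧
      a ∉ W ∧ c ≠ a ∧ ((k + 1 = r + s ∧ c = z ∧ W = u ∧ r' = of z) ∨
        (k + 1 = r ∧ c = b ∧ W = 1 ∧ r' = of z * u ^ m) ∨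
        (k + 1 = s ∧ c = z ∧ W = u ^ (m + 1) ∧ r' = of b)) := by
    rintro l r' (h | h | h) <;> obtain ⟨rfl, rfl⟩ := Prod.mk.inj h
    · exact ⟨r + s - 1, z, u, by rw [Nat.sub_add_cancel (by omega)], hu, haz, .inl ⟨by omega, rfl, rfl, rfl⟩⟩
    · exact ⟨r - 1, b, 1, by rw [Nat.sub_add_cancel hr, mul_one], notMem_one, hab,
        .inr (.inl ⟨by omega, rfl, rfl, rfl⟩)⟩
    · exact ⟨s - 1, z, u ^ (m + 1), by rw [Nat.sub_add_cancel hs], notMem_pow hu _, haz,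
        .inr (.inr ⟨by omega, rfl, rfl, rfl⟩)⟩
  obtain ⟨k₁, c₁, W₁, rfl, hW₁, hc₁, H₁⟩ := form _ _ h₁
  obtain ⟨k₂, c₂, W₂, rfl, hW₂, hc₂, H₂⟩ := form _ _ h₂
  simp only [mul_assoc] at e
  obtain ⟨i, rfl, hi, rfl, e'⟩ | ⟨p', rfl, e'⟩ := pow_of_mul_eq_mul_pow_of_mul hc₁ hc₂ e
  · rcases H₁ with ⟨hk, hc, rfl, rfl⟩ | ⟨hk, hc, rfl, rfl⟩ | ⟨hk, hc, rfl, rfl⟩ <;>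
    rcases H₂ with ⟨hk', hc', hW, rfl⟩ | ⟨hk', hc', hW, rfl⟩ | ⟨hk', hc', hW, rfl⟩ <;>
    subst hW <;> first
      | exact absurd (hc.symm.trans hc') hbz
      | exact absurd (hc'.symm.trans hc) hbz
      | (exfalso; omega)
      | (obtain rfl : i = 0 := by omega
         obtain rfl := mul_left_cancel e'
         rw [pow_zero, one_mul]
         exact ⟨_, .refl, .refl⟩)
      | skip
    obtain rfl : i = r := by omega
    rw [pow_succ', mul_assoc] at e'
    obtain rfl := mul_left_cancel e'
    exact ⟨_, .refl, reduces_of_mem (.inr (.inl rfl)) 1 v (by simp [mul_assoc]) (by simp [mul_assoc])⟩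
  · rw [pow_succ', mul_assoc] at e'
    obtain ⟨q, rfl, -⟩ := exists_eq_mul_of_notMem hW₁ e'
    exact absurd (by simp only [mul_assoc]) (hp q)

theorem notDvdRules_isConfluent (hr : 1 ≤ r) (hs : 1 ≤ s) (hab : b ≠ a) (haz : z ≠ a)
    (hbz : b ≠ z) (hu : a ∉ u) (hT : IsTerminating (notDvdRules a b z u r s m)) :
    IsConfluent (notDvdRules a b z u r s m) :=
  hT.isConfluent fun _ _ _ => locally_confluent_of_overlaps fun _ _ _ _ h₁ h₂ _ _ _ =>
    notDvdRules_overlap hr hs hab haz hbz hu h₁ h₂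

end NotDvd

section Overlaps

variable {A : Type} {a b z c h : A} {W₁ W₂ p t v w : Word A} {i j k d n α B : ℕ}

theorem overlap_cases (hi : i = 0 ∨ i = α) (hj : j = 0 ∨ j = α) (hc : c ≠ a)
    (hh : h ≠ a) (hW₁ : a ∉ W₁)
    (e : of a ^ i * (of c * W₁) * t = p * (of a ^ j * (of h * W₂) * v))
    (hp : ∀ q, p ≠ of a ^ i * (of c * W₁) * q) :
    (i = j ∧ p = 1 ∧ c = h ∧ W₁ * t = W₂ * v) ∨
      (i = α ∧ j = 0 ∧ p = of a ^ α ∧ c = h ∧ W₁ * t = W₂ * v) ∨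
      ∃ p', j = 0 ∧ p = of a ^ i * (of c * p') ∧ W₁ * t = p' * (of h * (W₂ * v)) ∧
        ∀ q, p' ≠ W₁ * q := by
  simp only [mul_assoc] at e
  obtain ⟨i', rfl, rfl, rfl, e'⟩ | ⟨p', rfl, e'⟩ := pow_of_mul_eq_mul_pow_of_mul hc hh e
  · obtain rfl | ⟨hi', rfl⟩ : i' = 0 ∨ i' = α ∧ j = 0 := by omega
    · exact .inl ⟨by omega, pow_zero _, rfl, e'⟩
    · exact .inr (.inl ⟨by omega, rfl, by rw [hi'], rfl, e'⟩)
  · rcases j with _ | j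
    · refine .inr (.inr ⟨p', rfl, rfl, by simpa using e', ?_⟩)
      rintro q rfl
      exact hp q (by simp only [mul_assoc])
    · rw [pow_succ', mul_assoc] at e'
      obtain ⟨q, rfl, -⟩ := exists_eq_mul_of_notMem hW₁ e'
      exact absurd (by simp only [mul_assoc]) (hp q)

theorem block_pow_mul_pow (w : Word A) :
    block b z B k ^ n * (of b ^ B * w) = of b ^ B * (block b z 0 (k + B) ^ n * w) := by
  rw [← mul_assoc, block, mul_pow_mul, mul_assoc, block, pow_zero, one_mul, pow_add]
  simp only [mul_assoc]

theorem block_pow_mul_block (w : Word A) :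
    block b z 0 (k + B) ^ n * (of z * (of b ^ k * w)) =
      of z * (of b ^ k * (block b z B k ^ n * w)) := by
  have := mul_pow_mul (of z * of b ^ k) (of b ^ B) n
  simp only [block, pow_zero, one_mul, pow_add, ← mul_assoc] at this ⊢
  rw [this]

theorem block_pow_mul_twist (w : Word A) :
    of z * (of b ^ k * (block b z (k + d) k ^ n * (of b ^ d * (of z * (of b ^ k * w))))) =
      block b z 0 (k + (k + d)) ^ n * (of z * (block b z (k + d) k * w)) := by
  rw [← block_pow_mul_block]
  simp only [block, pow_add, mul_assoc]

theorem block_mul_ne_pow_mul (hbz : b ≠ z) (k : ℕ) :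
    block b z B k * t ≠ of b ^ (B + 1) * v := by
  intro e
  simp only [block, mul_assoc] at e
  obtain ⟨m, hm, -⟩ := pow_of_mul_eq_pow_of_mul hbz.symm e
  omega

theorem pow_mul_block_eq (hbz : b ≠ z) (hk : 1 ≤ k) (hj : j ≤ n)
    (e : of b ^ k * (block b z (k + d) k ^ j * t) =
      block b z (k + d) k ^ n * (of b ^ (k + d) * w)) :
    j = 0 ∧ t = of b ^ d * (block b z 0 (k + (k + d)) ^ n * w) := by
  rcases j with _ | j
  · rw [block_pow_mul_pow, pow_zero, one_mul, pow_add, mul_assoc] at e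
    exact ⟨rfl, mul_left_cancel e⟩
  · obtain ⟨n, rfl⟩ : ∃ n', n = n' + 1 := ⟨n - 1, by omega⟩
    simp only [pow_succ', mul_assoc] at e
    nth_rw 1 3 [block] at e
    simp only [mul_assoc] at e
    rw [← mul_assoc, ← pow_add] at e
    have := (pow_of_mul_of_mul_inj hbz.symm hbz.symm e).1
    omega

end Overlaps

section Dvd

variable {A : Type} {a b z : A} {α n k d : ℕ}

/-- The rules used when `γ = (n + 1) * α`, `δ = k + 1` and `β = k + d + 1` with `k ≠ 0`. -/
def dvdRules (a b z : A) (α n k d : ℕ) : Set (Word A × Word A) :=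
  {(of a ^ α * (of z * block b z (k + d) k), of z),
    (of a ^ α * of b, of z * block b z (k + d) k ^ n),
    (of z * block b z (k + d) k ^ (n + 1), of b),
    (of a ^ α * (of z * of b ^ (k + d + 1)),
      of z * (of b ^ d * (of z * (of b ^ k * block b z (k + d) k ^ n)))),
    (of z * (block b z (k + d) k ^ n * of b ^ (k + d + 1)),
      of b ^ (d + 1) * (of z * (of b ^ k * block b z (k + d) k ^ n)))}

theorem dvdRules_overlap (hα : 1 ≤ α) (hk : 1 ≤ k) (hba : b ≠ a) (hza : z ≠ a) (hbz : b ≠ z)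
    {l₁ r₁ l₂ r₂ : Word A} (h₁ : (l₁, r₁) ∈ dvdRules a b z α n k d)
    (h₂ : (l₂, r₂) ∈ dvdRules a b z α n k d) {p t v : Word A} (e : l₁ * t = p * (l₂ * v))
    (hp : ∀ q, p ≠ l₁ * q) :
    Join (ReflTransGen (OneStep (dvdRules a b z α n k d))) (r₁ * t) (p * (r₂ * v)) := by
  have hU : a ∉ block b z (k + d) k := notMem_block hba.symm hza.symm
  have hb (i : ℕ) : a ∉ of b ^ i := notMem_pow (by simpa [mem_of] using hba.symm) i
  have hzb (i : ℕ) : z ∉ of b ^ i := notMem_pow (by simpa [mem_of] using hbz.symm) i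
  have m₂ : (of a ^ α * of b, of z * block b z (k + d) k ^ n) ∈ dvdRules a b z α n k d :=
    .inr (.inl rfl)
  have m₃ : (of z * block b z (k + d) k ^ (n + 1), of b) ∈ dvdRules a b z α n k d :=
    .inr (.inr (.inl rfl))
  have m₄ : (of a ^ α * (of z * of b ^ (k + d + 1)),
      of z * (of b ^ d * (of z * (of b ^ k * block b z (k + d) k ^ n)))) ∈
        dvdRules a b z α n k d := .inr (.inr (.inr (.inl rfl)))
  have m₅ : (of z * (block b z (k + d) k ^ n * of b ^ (k + d + 1)),
      of b ^ (d + 1) * (of z * (of b ^ k * block b z (k + d) k ^ n))) ∈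
        dvdRules a b z α n k d := .inr (.inr (.inr (.inr rfl)))
  have form : ∀ l r, (l, r) ∈ dvdRules a b z α n k d → ∃ i c W, l = of a ^ i * (of c * W) ∧
      a ∉ W ∧ c ≠ a ∧ ((i = α ∧ c = z ∧ W = block b z (k + d) k ∧ r = of z) ∨
        (i = α ∧ c = b ∧ W = 1 ∧ r = of z * block b z (k + d) k ^ n) ∨
        (i = 0 ∧ c = z ∧ W = block b z (k + d) k ^ (n + 1) ∧ r = of b) ∨
        (i = α ∧ c = z ∧ W = of b ^ (k + d + 1) ∧
          r = of z * (of b ^ d * (of z * (of b ^ k * block b z (k + d) k ^ n)))) ∨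
        (i = 0 ∧ c = z ∧ W = block b z (k + d) k ^ n * of b ^ (k + d + 1) ∧
          r = of b ^ (d + 1) * (of z * (of b ^ k * block b z (k + d) k ^ n)))) := by
    rintro l r (h | h | h | h | h) <;> obtain ⟨rfl, rfl⟩ := Prod.mk.inj h
    · exact ⟨α, z, _, rfl, hU, hza, .inl ⟨rfl, rfl, rfl, rfl⟩⟩
    · exact ⟨α, b, 1, by rw [mul_one], notMem_one, hba, .inr (.inl ⟨rfl, rfl, rfl, rfl⟩)⟩
    · exact ⟨0, z, _, by rw [pow_zero, one_mul], notMem_pow hU _, hza,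
        .inr (.inr (.inl ⟨rfl, rfl, rfl, rfl⟩))⟩
    · exact ⟨α, z, _, rfl, hb _, hza, .inr (.inr (.inr (.inl ⟨rfl, rfl, rfl, rfl⟩)))⟩
    · exact ⟨0, z, _, by rw [pow_zero, one_mul],
        fun h => (mem_mul.mp h).elim (notMem_pow hU _) (hb _), hza,
        .inr (.inr (.inr (.inr ⟨rfl, rfl, rfl, rfl⟩)))⟩
  obtain ⟨i, c, W₁, rfl, hW₁, hc, H₁⟩ := form _ _ h₁
  obtain ⟨j, h, W₂, rfl, -, hh, H₂⟩ := form _ _ h₂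
  obtain ⟨rfl, rfl, rfl, e'⟩ | ⟨rfl, rfl, rfl, rfl, e'⟩ | ⟨p', rfl, rfl, e', hp'⟩ :=
    overlap_cases (α := α) (by omega) (by omega) hc hh hW₁ e hp
  · rcases H₁ with ⟨hi, hc, rfl, rfl⟩ | ⟨hi, hc, rfl, rfl⟩ | ⟨hi, hc, rfl, rfl⟩ |
      ⟨hi, hc, rfl, rfl⟩ | ⟨hi, hc, rfl, rfl⟩ <;>
    rcases H₂ with ⟨hj, hh, hW, rfl⟩ | ⟨hj, hh, hW, rfl⟩ | ⟨hj, hh, hW, rfl⟩ |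
      ⟨hj, hh, hW, rfl⟩ | ⟨hj, hh, hW, rfl⟩ <;>
    subst hW <;> first
      | exact absurd (hc.symm.trans hh) hbz
      | exact absurd (hh.symm.trans hc) hbz
      | (exfalso; omega)
      | (rw [mul_right_inj] at e'
         subst e'
         rw [one_mul]
         exact ⟨_, .refl, .refl⟩)
      | skip
    · exact absurd e' (block_mul_ne_pow_mul hbz k)
    · rw [pow_succ (block _ _ _ _), mul_assoc, mul_assoc, mul_right_inj] at e'
      exact absurd e' (block_mul_ne_pow_mul hbz k)
    · exact absurd e'.symm (block_mul_ne_pow_mul hbz k)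
    · rw [pow_succ (block _ _ _ _), mul_assoc, mul_assoc, mul_right_inj] at e'
      exact absurd e'.symm (block_mul_ne_pow_mul hbz k)
  · rcases H₁ with ⟨hi, hc, rfl, rfl⟩ | ⟨hi, hc, rfl, rfl⟩ | ⟨hi, hc, rfl, rfl⟩ |
      ⟨hi, hc, rfl, rfl⟩ | ⟨hi, hc, rfl, rfl⟩ <;>
    rcases H₂ with ⟨hj, hh, rfl, rfl⟩ | ⟨hj, hh, rfl, rfl⟩ | ⟨hj, hh, rfl, rfl⟩ |
      ⟨hj, hh, rfl, rfl⟩ | ⟨hj, hh, rfl, rfl⟩ <;> first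
      | exact absurd (hc.symm.trans hh) hbz
      | exact absurd (hh.symm.trans hc) hbz
      | (exfalso; omega)
      | skip
    all_goals subst hc
    · rw [pow_succ', mul_assoc, mul_right_inj] at e'
      subst e'
      exact ⟨_, .refl, reduces_of_mem m₂ 1 v (by simp only [one_mul, mul_assoc])
        (by simp only [one_mul, mul_assoc])⟩
    · rcases n with _ | n
      · rw [pow_zero, one_mul] at e'
        exact absurd e' (block_mul_ne_pow_mul hbz k)
      · rw [pow_succ', mul_assoc, mul_assoc, mul_right_inj] at e'
        subst e'
        have hUU (w : Word A) : block b c (k + d) k * (of b ^ d * (of c * (of b ^ k * w))) =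
            of b ^ (k + d) * (of c * (block b c (k + d) k * w)) := by
          simp only [block, pow_add, mul_assoc]
        refine ⟨of c * (block b c (k + d) k ^ n * (of b ^ (k + d + 1) * v)), .refl, ?_⟩
        refine .trans (reduces_of_mem m₂ 1
          (of b ^ d * (of c * (of b ^ k * (block b c (k + d) k ^ (n + 1) * v)))) ?_ rfl)
          (reduces_of_mem m₃ (of c * (block b c (k + d) k ^ n * of b ^ (k + d))) v ?_ ?_)
        · simp only [pow_succ' (of b) d, one_mul, mul_assoc]
        · rw [pow_succ (block _ _ _ _) n, pow_succ' _ (n + 1), pow_succ (block _ _ _ _) n]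
          simp only [hUU, one_mul, mul_assoc]
        · simp only [pow_succ (of b), mul_assoc]
    · rw [pow_succ' (block _ _ _ _), mul_assoc] at e'
      exact absurd e'.symm (block_mul_ne_pow_mul hbz k)
    · rcases n with _ | n
      · rw [pow_zero, one_mul, mul_right_inj] at e'
        subst e'
        exact ⟨_, .refl, reduces_of_mem m₂ 1 (of b ^ d * (of c * (of b ^ k * t)))
          (by simp only [pow_zero, pow_succ' (of b), mul_one, one_mul, mul_assoc])
          (by simp only [pow_zero, mul_one, one_mul, mul_assoc])⟩
      · rw [pow_succ' (block _ _ _ _), mul_assoc, mul_assoc] at e'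
        exact absurd e'.symm (block_mul_ne_pow_mul hbz k)
  · obtain rfl : h = z := by
      rcases H₂ with H | H | H | H | H <;> first | exact H.2.1 | (exfalso; omega)
    obtain ⟨w, hw, Hw⟩ : ∃ w, W₂ * v =
          block b h (k + d) k ^ n * (of b ^ (k + d) * w) ∧
        (w = of h * (of b ^ k * v) ∧ r₂ = of b ∨ w = of b * v ∧
          r₂ = of b ^ (d + 1) * (of h * (of b ^ k * block b h (k + d) k ^ n))) := by
      rcases H₂ with H | H | ⟨-, -, rfl, rfl⟩ | H | ⟨-, -, rfl, rfl⟩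
      · omega
      · omega
      · exact ⟨_, by rw [pow_succ]; nth_rw 2 [block]; simp only [mul_assoc], .inl ⟨rfl, rfl⟩⟩
      · omega
      · exact ⟨_, by rw [pow_succ]; simp only [mul_assoc], .inr ⟨rfl, rfl⟩⟩
    rw [hw] at e'
    have hV (w : Word A) := block_pow_mul_block (b := b) (z := h) (n := n) (k := k) (B := k + d) w
    rcases H₁ with ⟨rfl, rfl, rfl, rfl⟩ | ⟨rfl, rfl, rfl, rfl⟩ | ⟨rfl, rfl, rfl, rfl⟩ |
      ⟨rfl, rfl, rfl, rfl⟩ | ⟨rfl, rfl, rfl, rfl⟩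
    · obtain ⟨i', j', hij, rfl, e''⟩ | ⟨q, rfl, -⟩ := pow_block_mul_eq_mul hbz.symm
        ((congrArg (· * t) (pow_one _)).trans e')
      swap
      · exact absurd (by rw [pow_one]) (hp' q)
      obtain ⟨rfl, rfl⟩ : i' = 0 ∧ j' = 0 := by omega
      obtain ⟨-, rfl⟩ := pow_mul_block_eq hbz hk (Nat.zero_le n) e''.symm
      obtain ⟨rfl, rfl⟩ | ⟨rfl, rfl⟩ := Hw
      · exact ⟨_, .refl, reduces_of_mem m₄ 1 v
          (by simp only [pow_zero, pow_succ (of b), one_mul, mul_assoc])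
          (by simp only [hV, one_mul, mul_assoc])⟩
      · refine ⟨_, .refl, .trans
          (reduces_of_mem m₄ 1 (of b ^ d * (of c * (of b ^ k * (block b c (k + d) k ^ n * v)))) ?_ rfl)
          (reduces_of_mem m₃ (of c * (of b ^ d * block b c 0 (k + (k + d)) ^ n)) v ?_ ?_)⟩
        · simp only [pow_zero, pow_succ (of b) (k + d), pow_succ' (of b) d, one_mul, mul_assoc]
        · simp only [pow_succ' (block _ _ _ _), block_pow_mul_twist, one_mul, mul_assoc]
        · simp only [mul_assoc]
    · exact absurd (one_mul _).symm (hp' p')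
    · obtain ⟨i', j', hij, rfl, e''⟩ | ⟨q, rfl, -⟩ := pow_block_mul_eq_mul hbz.symm e'
      swap
      · exact absurd rfl (hp' q)
      obtain ⟨rfl, rfl⟩ := pow_mul_block_eq hbz hk (by omega) e''.symm
      obtain rfl : i' = n := by omega
      obtain ⟨rfl, rfl⟩ | ⟨rfl, rfl⟩ := Hw
      · exact ⟨_, .refl, reduces_of_mem m₅ 1 v
          (by simp only [pow_zero, pow_succ (of b) (k + d), one_mul, mul_assoc])
          (by simp only [hV, pow_succ' (of b) d, one_mul, mul_assoc])⟩
      · refine ⟨_, .refl, .trans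
          (reduces_of_mem m₅ 1 (of b ^ d * (of c * (of b ^ k * (block b c (k + d) k ^ i' * v)))) ?_ rfl)
          (reduces_of_mem m₃ (of b ^ (d + 1) * block b c 0 (k + (k + d)) ^ i') v ?_ ?_)⟩
        · simp only [pow_zero, pow_succ (of b) (k + d), pow_succ' (of b) d, one_mul, mul_assoc]
        · simp only [pow_succ' (block _ _ _ _), block_pow_mul_twist, one_mul, mul_assoc]
        · simp only [pow_succ' (of b) d, mul_assoc]
    · obtain ⟨q, rfl, -⟩ := exists_eq_mul_of_notMem (hzb _) e'
      exact absurd rfl (hp' q)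
    · rw [mul_assoc] at e'
      obtain ⟨i', j', hij, rfl, e''⟩ | ⟨p', rfl, e''⟩ := pow_block_mul_eq_mul hbz.symm e'
      · have e₃ := (pow_mul_block_eq hbz hk (by omega) e''.symm).2
        rw [← hij, pow_succ' (block _ _ _ _), mul_assoc] at e₃
        nth_rw 1 [block] at e₃
        rw [pow_zero, one_mul, mul_assoc] at e₃
        obtain ⟨m, hm, -⟩ := pow_of_mul_eq_pow_of_mul hbz.symm e₃.symm
        omega
      · obtain ⟨q, rfl, -⟩ := exists_eq_mul_of_notMem (hzb _) e''
        exact absurd (mul_assoc _ _ _).symm (hp' q)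

theorem dvdRules_isConfluent (hα : 1 ≤ α) (hk : 1 ≤ k) (hba : b ≠ a) (hza : z ≠ a) (hbz : b ≠ z)
    (hT : IsTerminating (dvdRules a b z α n k d)) : IsConfluent (dvdRules a b z α n k d) :=
  hT.isConfluent fun _ _ _ => locally_confluent_of_overlaps fun _ _ _ _ h₁ h₂ _ _ _ =>
    dvdRules_overlap hα hk hba hza hbz h₁ h₂

end Dvd

section DvdOne

variable {A : Type} {a b z : A} {t v w : Word A} {α n B i : ℕ}

/-- The rules used when `γ = (n + 1) * α`, `δ = 1` and `β = B + 1`. -/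
def dvdOneRules (a b z : A) (α n B : ℕ) : Set (Word A × Word A) :=
  {(of a ^ α * (of z * block b z B 0), of z),
    (of a ^ α * of b, of z * block b z B 0 ^ n),
    (of z * block b z B 0 ^ (n + 1), of b),
    (of z * of b ^ (B + 1), of b ^ (B + 1) * of z)}

theorem dvdOneRules_block_pow (i : ℕ) (w : Word A) :
    ReflTransGen (OneStep (dvdOneRules a b z α n B))
      (of z * (block b z B 0 ^ i * (of b ^ (B + 1) * w))) (of b * (block b z B 0 ^ (i + 1) * w)) := by
  have m₄ : (of z * of b ^ (B + 1), of b ^ (B + 1) * of z) ∈ dvdOneRules a b z α n B :=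
    .inr (.inr (.inr rfl))
  induction i generalizing w with
  | zero =>
    exact reduces_of_mem m₄ 1 w (by simp only [pow_zero, one_mul, mul_assoc])
      (by simp only [block, pow_zero, pow_one, zero_add, mul_one, one_mul, mul_assoc,
        pow_succ' (of b)])
  | succ i ih =>
    refine .trans (reduces_of_mem m₄ (of z * (block b z B 0 ^ i * of b ^ B)) w ?_ rfl) ?_
    · rw [pow_succ (block _ _ _ _)]
      nth_rw 2 [block]
      simp only [pow_zero, mul_one, mul_assoc]
    · convert ih (block b z B 0 * w) using 1
      · simp only [block, pow_zero, mul_one, mul_assoc]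
        rw [← mul_assoc (of b ^ B), pow_mul_comm, mul_assoc]
      · rw [pow_succ _ (i + 1), mul_assoc]

theorem dvdOneRules_overlap (hα : 1 ≤ α) (hba : b ≠ a) (hza : z ≠ a) (hbz : b ≠ z)
    {l₁ r₁ l₂ r₂ : Word A} (h₁ : (l₁, r₁) ∈ dvdOneRules a b z α n B)
    (h₂ : (l₂, r₂) ∈ dvdOneRules a b z α n B) {p t v : Word A} (e : l₁ * t = p * (l₂ * v))
    (hp : ∀ q, p ≠ l₁ * q) :
    Join (ReflTransGen (OneStep (dvdOneRules a b z α n B))) (r₁ * t) (p * (r₂ * v)) := by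
  have hU : a ∉ block b z B 0 := notMem_block hba.symm hza.symm
  have hb (i : ℕ) : a ∉ of b ^ i := notMem_pow (by simpa [mem_of] using hba.symm) i
  have hzb (i : ℕ) : z ∉ of b ^ i := notMem_pow (by simpa [mem_of] using hbz.symm) i
  have hzU (w : Word A) : of b ^ (B + 1) * (of z * w) = of b * (block b z B 0 * w) := by
    simp only [block, pow_succ' (of b) B, pow_zero, mul_one, mul_assoc]
  have m₂ : (of a ^ α * of b, of z * block b z B 0 ^ n) ∈ dvdOneRules a b z α n B :=
    .inr (.inl rfl)
  have m₃ : (of z * block b z B 0 ^ (n + 1), of b) ∈ dvdOneRules a b z α n B :=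
    .inr (.inr (.inl rfl))
  have m₄ : (of z * of b ^ (B + 1), of b ^ (B + 1) * of z) ∈ dvdOneRules a b z α n B :=
    .inr (.inr (.inr rfl))
  have abU (w : Word A) : ReflTransGen (OneStep (dvdOneRules a b z α n B))
      (of a ^ α * (of b * (block b z B 0 * w))) (of b * w) :=
    .trans (reduces_of_mem m₂ 1 (block b z B 0 * w) (by simp only [one_mul, mul_assoc]) rfl)
      (reduces_of_mem m₃ 1 w (by simp only [pow_succ, one_mul, mul_assoc]) (one_mul _).symm)
  have azb (w : Word A) : ReflTransGen (OneStep (dvdOneRules a b z α n B))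
      (of a ^ α * (of z * (of b ^ (B + 1) * w))) (of b * w) := by
    refine .trans (reduces_of_mem m₄ (of a ^ α) w (by simp only [mul_assoc]) rfl) ?_
    rw [mul_assoc, hzU]
    exact abU w
  have form : ∀ l r, (l, r) ∈ dvdOneRules a b z α n B → ∃ i c W, l = of a ^ i * (of c * W) ∧
      a ∉ W ∧ c ≠ a ∧ ((i = α ∧ c = z ∧ W = block b z B 0 ∧ r = of z) ∨
        (i = α ∧ c = b ∧ W = 1 ∧ r = of z * block b z B 0 ^ n) ∨
        (i = 0 ∧ c = z ∧ W = block b z B 0 ^ (n + 1) ∧ r = of b) ∨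
        (i = 0 ∧ c = z ∧ W = of b ^ (B + 1) ∧ r = of b ^ (B + 1) * of z)) := by
    rintro l r (h | h | h | h) <;> obtain ⟨rfl, rfl⟩ := Prod.mk.inj h
    · exact ⟨α, z, _, rfl, hU, hza, .inl ⟨rfl, rfl, rfl, rfl⟩⟩
    · exact ⟨α, b, 1, by rw [mul_one], notMem_one, hba, .inr (.inl ⟨rfl, rfl, rfl, rfl⟩)⟩
    · exact ⟨0, z, _, by rw [pow_zero, one_mul], notMem_pow hU _, hza,
        .inr (.inr (.inl ⟨rfl, rfl, rfl, rfl⟩))⟩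
    · exact ⟨0, z, _, by rw [pow_zero, one_mul], hb _, hza,
        .inr (.inr (.inr ⟨rfl, rfl, rfl, rfl⟩))⟩
  obtain ⟨i, c, W₁, rfl, hW₁, hc, H₁⟩ := form _ _ h₁
  obtain ⟨j, h, W₂, rfl, -, hh, H₂⟩ := form _ _ h₂
  obtain ⟨rfl, rfl, rfl, e'⟩ | ⟨rfl, rfl, rfl, rfl, e'⟩ | ⟨p', rfl, rfl, e', hp'⟩ :=
    overlap_cases (α := α) (by omega) (by omega) hc hh hW₁ e hp
  · rcases H₁ with ⟨hi, hc, rfl, rfl⟩ | ⟨hi, hc, rfl, rfl⟩ | ⟨hi, hc, rfl, rfl⟩ |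
      ⟨hi, hc, rfl, rfl⟩ <;>
    rcases H₂ with ⟨hj, hh, hW, rfl⟩ | ⟨hj, hh, hW, rfl⟩ | ⟨hj, hh, hW, rfl⟩ |
      ⟨hj, hh, hW, rfl⟩ <;>
    subst hW <;> first
      | exact absurd (hc.symm.trans hh) hbz
      | exact absurd (hh.symm.trans hc) hbz
      | (exfalso; omega)
      | (rw [mul_right_inj] at e'
         subst e'
         rw [one_mul]
         exact ⟨_, .refl, .refl⟩)
      | skip
    · rw [pow_succ' (block _ _ _ _), mul_assoc] at e'
      exact absurd e' (block_mul_ne_pow_mul hbz 0)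
    · rw [pow_succ' (block _ _ _ _), mul_assoc] at e'
      exact absurd e'.symm (block_mul_ne_pow_mul hbz 0)
  · rcases H₁ with ⟨hi, hc, rfl, rfl⟩ | ⟨hi, hc, rfl, rfl⟩ | ⟨hi, hc, rfl, rfl⟩ |
      ⟨hi, hc, rfl, rfl⟩ <;>
    rcases H₂ with ⟨hj, hh, rfl, rfl⟩ | ⟨hj, hh, rfl, rfl⟩ | ⟨hj, hh, rfl, rfl⟩ |
      ⟨hj, hh, rfl, rfl⟩ <;> first
      | exact absurd (hc.symm.trans hh) hbz
      | exact absurd (hh.symm.trans hc) hbz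
      | (exfalso; omega)
      | skip
    all_goals subst hc
    · rw [pow_succ', mul_assoc, mul_right_inj] at e'
      subst e'
      exact ⟨_, .refl, reduces_of_mem m₂ 1 v (by simp only [one_mul, mul_assoc])
        (by simp only [one_mul, mul_assoc])⟩
    · exact absurd e' (block_mul_ne_pow_mul hbz 0)
  · obtain rfl : h = z := by
      rcases H₂ with H | H | H | H <;> first | exact H.2.1 | (exfalso; omega)
    rcases H₁ with ⟨rfl, rfl, rfl, rfl⟩ | ⟨rfl, rfl, rfl, rfl⟩ | ⟨rfl, rfl, rfl, rfl⟩ |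
      ⟨rfl, rfl, rfl, rfl⟩
    · obtain ⟨i', j', hij, rfl, e''⟩ | ⟨q, rfl, -⟩ := pow_block_mul_eq_mul hbz.symm
        ((congrArg (· * t) (pow_one _)).trans e')
      swap
      · exact absurd (by rw [pow_one]) (hp' q)
      obtain ⟨rfl, rfl⟩ : i' = 0 ∧ j' = 0 := by omega
      rw [pow_zero, pow_zero, one_mul, one_mul] at e''
      subst e''
      rcases H₂ with H | H | ⟨-, -, rfl, rfl⟩ | ⟨-, -, rfl, rfl⟩
      · omega
      · omega
      · refine ⟨_, reduces_of_mem m₃ 1 v (by simp only [one_mul, mul_assoc]) (one_mul _).symm, ?_⟩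
        simpa only [pow_zero, pow_succ (of b), one_mul, mul_assoc] using azb v
      · refine ⟨_, reduces_of_mem m₄ 1 v (by simp only [one_mul, mul_assoc]) (one_mul _).symm, ?_⟩
        convert azb (of b ^ B * (of c * v)) using 1
        · rw [← mul_assoc (of b ^ (B + 1)) (of b ^ B), pow_mul_comm]
          simp only [pow_zero, one_mul, mul_assoc]
        · simp only [pow_succ', mul_assoc]
    · exact absurd (one_mul _).symm (hp' p')
    · obtain ⟨i', j', hij, rfl, e''⟩ | ⟨q, rfl, -⟩ := pow_block_mul_eq_mul hbz.symm e'
      swap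
      · exact absurd rfl (hp' q)
      rw [pow_zero, one_mul] at e''
      have R (w : Word A) := dvdOneRules_block_pow (a := a) (b := b) (z := c) (α := α) (n := n)
        (B := B) i' w
      rcases H₂ with H | H | ⟨-, -, rfl, rfl⟩ | ⟨-, -, rfl, rfl⟩
      · omega
      · omega
      · obtain rfl : n = j' + i' := by omega
        rw [add_assoc, pow_add, mul_assoc, mul_right_inj] at e''
        subst e''
        exact ⟨_, .refl, by simpa only [pow_zero, pow_succ (of b), one_mul, mul_assoc] using R v⟩
      · rcases j' with _ | j'
        · obtain rfl : i' = n := by omega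
          rw [pow_zero, one_mul] at e''
          subst e''
          refine ⟨_, .refl, .trans (b := of b * (block b c B 0 ^ (i' + 1) * (block b c B 0 * v))) ?_
            (reduces_of_mem m₃ (of b ^ (B + 1)) v ?_ ?_)⟩
          · convert R (of b ^ B * (of c * v)) using 1
            · rw [← mul_assoc (of b ^ (B + 1)) (of b ^ B), pow_mul_comm]
              simp only [pow_zero, one_mul, mul_assoc]
            · simp only [block, pow_zero, mul_one, mul_assoc]
          · rw [mul_assoc, hzU, ← mul_assoc _ (block _ _ _ _), ← pow_succ, pow_succ', mul_assoc]
          · rw [← mul_assoc, ← mul_assoc, ← pow_succ, ← pow_succ']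
        · rw [pow_succ' (block _ _ _ _), mul_assoc] at e''
          exact absurd e''.symm (block_mul_ne_pow_mul hbz 0)
    · obtain ⟨q, rfl, -⟩ := exists_eq_mul_of_notMem (hzb _) e'
      exact absurd rfl (hp' q)

theorem dvdOneRules_isConfluent (hα : 1 ≤ α) (hba : b ≠ a) (hza : z ≠ a) (hbz : b ≠ z)
    (hT : IsTerminating (dvdOneRules a b z α n B)) : IsConfluent (dvdOneRules a b z α n B) :=
  hT.isConfluent fun _ _ _ => locally_confluent_of_overlaps fun _ _ _ _ h₁ h₂ _ _ _ =>
    dvdOneRules_overlap hα hba hza hbz h₁ h₂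

end DvdOne

section Termination

variable {α r s m n k d B : ℕ}

instance : Fintype AB := ⟨⟨{.a, .b}, by simp⟩, fun y => by cases y <;> simp⟩

instance : Fintype ABX := ⟨⟨{.a, .b, .x}, by simp⟩, fun y => by cases y <;> simp⟩

/-- Weights under which `a` outweighs everything that replaces it. -/
def abxWeight (N : ℕ) : ABX → ℕ
  | .a => N + 1
  | _ => 1

theorem isTerminating_of_abxWeight (N : ℕ) {R : Set (Word ABX × Word ABX)}
    (h : ∀ l r, (l, r) ∈ R → wordWeight (abxWeight N) r < wordWeight (abxWeight N) l ∨
      (wordWeight (abxWeight N) r = wordWeight (abxWeight N) l ∧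
        ∃ l' r', l = of ABX.x * l' ∧ r = of ABX.b * r')) :
    IsTerminating R := by
  refine isTerminating_of_weight (abxWeight N) (fun | .x => 1 | _ => 0)
    (fun y => by cases y <;> simp [abxWeight]) fun l r hlr => (h l r hlr).imp_right ?_
  rintro ⟨h, l', r', rfl, rfl⟩
  exact ⟨h, _, _, l', r', rfl, rfl, Nat.zero_lt_one⟩

theorem wordWeight_block {A : Type} (wt : A → ℕ) (b z : A) (i j : ℕ) :
    wordWeight wt (block b z i j) = i * wt b + (wt z + j * wt b) := by
  simp only [block, wordWeight_mul, wordWeight_pow, wordWeight_of]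

theorem notDvdRules_isTerminating (hr : 1 ≤ r) (i j : ℕ) :
    IsTerminating (notDvdRules ABX.a .b .x (block .b .x i j) r s m) := by
  refine isTerminating_of_abxWeight (m * (i + (1 + j))) ?_
  rintro l r' (h | h | h) <;> obtain ⟨rfl, rfl⟩ := Prod.mk.inj h <;> left <;>
    simp only [wordWeight_mul, wordWeight_pow, wordWeight_of, wordWeight_block, abxWeight, mul_one]
  · omega
  · have := Nat.le_mul_of_pos_left (m * (i + (1 + j)) + 1) hr
    omega
  · rw [add_mul m]
    omega

theorem dvdRules_isTerminating (hα : 1 ≤ α) : IsTerminating (dvdRules ABX.a .b .x α n k d) := by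
  have hN := Nat.le_mul_of_pos_left (n * (k + d + (1 + k)) + 1) hα
  refine isTerminating_of_abxWeight (n * (k + d + (1 + k))) ?_
  rintro l r (h | h | h | h | h) <;> obtain ⟨rfl, rfl⟩ := Prod.mk.inj h <;>
    simp only [wordWeight_mul, wordWeight_pow, wordWeight_of, wordWeight_block, abxWeight, mul_one]
  · omega
  · omega
  · rw [add_mul n]
    omega
  · omega
  · refine .inr ⟨by omega, _, _, rfl, (congrArg (· * _) (pow_succ' _ _)).trans (mul_assoc _ _ _)⟩

theorem dvdOneRules_isTerminating (hα : 1 ≤ α) : IsTerminating (dvdOneRules ABX.a .b .x α n B) := by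
  have hN := Nat.le_mul_of_pos_left (n * (B + (1 + 0)) + 1) hα
  refine isTerminating_of_abxWeight (n * (B + (1 + 0))) ?_
  rintro l r (h | h | h | h) <;> obtain ⟨rfl, rfl⟩ := Prod.mk.inj h <;>
    simp only [wordWeight_mul, wordWeight_pow, wordWeight_of, wordWeight_block, abxWeight, mul_one]
  · omega
  · omega
  · rw [add_mul n]
    omega
  · refine .inr ⟨by omega, _, _, rfl, (congrArg (· * _) (pow_succ' _ _)).trans (mul_assoc _ _ _)⟩

end Termination

section Presentation

variable {M : Type} [Monoid M] {a b u z : M} {r s m n k d B : ℕ}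

theorem pow_mul_mul_pow_eq (h : a * (b * u) = b) (n : ℕ) : a ^ n * (b * u ^ n) = b := by
  induction n with
  | zero => simp
  | succ n ih =>
    calc a ^ (n + 1) * (b * u ^ (n + 1)) = a * (a ^ n * (b * u ^ n) * u) := by
          simp only [pow_succ' a, pow_succ u, mul_assoc]
      _ = b := by rw [ih, h]

/-- Adjoining a name for `a ^ ((r + s) * m + r) * b` turns the relation `a ^ (r + s) * b * u = b`
into three shorter ones. -/
theorem relations_iff :
    z = a ^ ((r + s) * m + r) * b ∧ a ^ (r + s) * (b * u) = b ↔
      a ^ (r + s) * (z * u) = z ∧ a ^ r * b = z * u ^ m ∧ a ^ s * (z * u ^ (m + 1)) = b := by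
  constructor
  · rintro ⟨rfl, h⟩
    have h' (n : ℕ) : a ^ ((r + s) * n) * (b * u ^ n) = b := by
      rw [pow_mul]
      exact pow_mul_mul_pow_eq h n
    refine ⟨?_, ?_, ?_⟩
    · rw [mul_assoc, ← mul_assoc, ← pow_add, add_comm, pow_add, mul_assoc, h]
    · rw [add_comm, pow_add, mul_assoc, mul_assoc, h']
    · rw [mul_assoc, ← mul_assoc, ← pow_add]
      convert h' (m + 1) using 3
      ring
  · rintro ⟨h₁, h₂, h₃⟩
    refine ⟨?_, ?_⟩
    · rw [pow_add, mul_assoc, h₂, pow_mul, pow_mul_mul_pow_eq h₁]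
    · rw [add_comm, pow_add, mul_assoc, ← mul_assoc _ b, h₂, mul_assoc, ← pow_succ, h₃]

theorem pow_add_add_one_eq (h : z * (b ^ (k + d) * (z * b ^ k)) ^ (n + 1) = b) :
    b ^ (k + d + 1) = b ^ (k + d) * (z * b ^ k) *
      (b ^ d * (z * (b ^ k * (b ^ (k + d) * (z * b ^ k)) ^ n))) := by
  rw [pow_succ b (k + d)]
  nth_rw 2 [← h]
  rw [pow_succ' _ n, pow_add]
  simp only [mul_assoc]

end Presentation

section Isomorphism

variable {α β γ δ : ℕ}

/-- To adjoin a name `x` for `a ^ γ * b`, it suffices that the new rules and the old relation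
together with `x = a ^ γ * b` hold in the same monoids. -/
theorem nonempty_presEquiv_of_iff {R : Set (Word ABX × Word ABX)}
    (h : ∀ {M : Type} [Monoid M] (φ : Word ABX →* M), (∀ l r, (l, r) ∈ R → φ l = φ r) ↔
      φ (of .x) = φ (of .a) ^ γ * φ (of .b) ∧
        φ (of .a) ^ α * φ (of .b) ^ β * φ (of .a) ^ γ * φ (of .b) ^ δ = φ (of .b)) :
    Nonempty (MonPres R ≃* MonPres ({((of AB.a) ^ α * (of AB.b) ^ β * (of AB.a) ^ γ * (of AB.b) ^ δ,
      of AB.b)} : Set (Word AB × Word AB))) := by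
  set S : Set (Word AB × Word AB) :=
    {((of AB.a) ^ α * (of AB.b) ^ β * (of AB.a) ^ γ * (of AB.b) ^ δ, of AB.b)}
  obtain ⟨hx, hS⟩ := (h (presMk R)).mp fun _ _ => presMk_eq_of_mem
  refine nonempty_presEquiv (fun | .a => of .a | .b => of .b | .x => of .a ^ γ * of .b)
    (fun | .a => of .a | .b => of .b) ((h ((presMk S).comp (lift _))).mpr ?_) ?_ ?_ ?_
  · have : presMk S _ = _ := presMk_eq_of_mem rfl
    simpa using this
  · rintro l r hlr
    obtain ⟨rfl, rfl⟩ := Prod.mk.inj hlr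
    simpa using hS
  · rintro (_ | _ | _) <;> simp [hx]
  · rintro (_ | _) <;> simp

theorem map_block {A M : Type} [Monoid M] (φ : Word A →* M) (b z : A) (i j : ℕ) :
    φ (block b z i j) = φ (of b) ^ i * (φ (of z) * φ (of b) ^ j) := by
  simp [block]

theorem relation_eq_iff {M : Type} [Monoid M] {a b z : M} {B k : ℕ} (h : z = a ^ γ * b) :
    a ^ α * b ^ (B + 1) * a ^ γ * b ^ (k + 1) = b ↔ a ^ α * (b * (b ^ B * (z * b ^ k))) = b := by
  rw [h]
  simp only [pow_succ' b, mul_assoc]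

theorem notDvdRules_presEquiv {r s m B k : ℕ} :
    Nonempty (MonPres (notDvdRules ABX.a .b .x (block .b .x B k) r s m) ≃*
      MonPres ({((of AB.a) ^ (r + s) * (of AB.b) ^ (B + 1) * (of AB.a) ^ ((r + s) * m + r) *
        (of AB.b) ^ (k + 1), of AB.b)} : Set (Word AB × Word AB))) :=
  nonempty_presEquiv_of_iff fun φ => by
    rw [and_congr_right relation_eq_iff, relations_iff]
    simp [notDvdRules, map_block, or_imp, forall_and]

theorem dvdRules_presEquiv {α n k d : ℕ} :
    Nonempty (MonPres (dvdRules ABX.a .b .x α n k d) ≃*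
      MonPres ({((of AB.a) ^ α * (of AB.b) ^ (k + d + 1) * (of AB.a) ^ (α * n + α) *
        (of AB.b) ^ (k + 1), of AB.b)} : Set (Word AB × Word AB))) :=
  nonempty_presEquiv_of_iff fun φ => by
    rw [and_congr_right relation_eq_iff]
    have := relations_iff (a := φ (of .a)) (b := φ (of .b)) (z := φ (of .x)) (r := α) (s := 0) (m := n)
      (u := φ (of .b) ^ (k + d) * (φ (of .x) * φ (of .b) ^ k))
    rw [add_zero] at this
    rw [this]
    simp only [dvdRules, Set.mem_insert_iff, Set.mem_singleton_iff, Prod.mk.injEq, or_imp, and_imp,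
      forall_and, forall_eq_apply_imp_iff, forall_eq, map_mul, map_pow, map_block, pow_zero, one_mul]
    refine ⟨fun ⟨h₁, h₂, h₃, _⟩ => ⟨h₁, h₂, h₃⟩, fun ⟨h₁, h₂, h₃⟩ => ⟨h₁, h₂, h₃, ?_, ?_⟩⟩
    · rw [pow_add_add_one_eq h₃, ← mul_assoc (φ (of .x)), ← mul_assoc (_ ^ α), h₁]
    · rw [pow_add_add_one_eq h₃, ← mul_assoc (_ ^ n), ← pow_succ, ← mul_assoc, h₃, ← mul_assoc,
        ← pow_succ']

theorem dvdOneRules_presEquiv {α n B : ℕ} :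
    Nonempty (MonPres (dvdOneRules ABX.a .b .x α n B) ≃*
      MonPres ({((of AB.a) ^ α * (of AB.b) ^ (B + 1) * (of AB.a) ^ (α * n + α) *
        (of AB.b) ^ (0 + 1), of AB.b)} : Set (Word AB × Word AB))) :=
  nonempty_presEquiv_of_iff fun φ => by
    rw [and_congr_right relation_eq_iff]
    have := relations_iff (a := φ (of .a)) (b := φ (of .b)) (z := φ (of .x)) (r := α) (s := 0) (m := n)
      (u := φ (of .b) ^ B * (φ (of .x) * φ (of .b) ^ 0))
    rw [add_zero] at this
    rw [this]
    simp only [dvdOneRules, Set.mem_insert_iff, Set.mem_singleton_iff, Prod.mk.injEq, or_imp, and_imp,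
      forall_and, forall_eq_apply_imp_iff, forall_eq, map_mul, map_pow, map_block, pow_zero, one_mul,
      mul_one]
    refine ⟨fun ⟨h₁, h₂, h₃, _⟩ => ⟨h₁, h₂, h₃⟩, fun ⟨h₁, h₂, h₃⟩ => ⟨h₁, h₂, h₃, ?_⟩⟩
    have hb : φ (of .b) ^ (B + 1) = (φ (of .b) ^ B * φ (of .x)) ^ (n + 2) := by
      rw [pow_succ]
      nth_rw 2 [← h₃]
      rw [← mul_assoc, ← pow_succ']
    rw [hb, pow_succ _ (n + 1), ← mul_assoc, h₃, ← mul_assoc, ← pow_succ', hb, pow_succ _ (n + 1), mul_assoc]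

end Isomorphism

section NoOverlap

variable {A : Type} {a b : A} {i j k B : ℕ}

theorem overlap_eq_one (hba : b ≠ a) (hik : ¬ (i ≤ j ∧ k ≤ B)) {p t v : Word A}
    (e : of a ^ (i + 1) * of b ^ (B + 1) * of a ^ (j + 1) * of b ^ (k + 1) * t =
      p * (of a ^ (i + 1) * of b ^ (B + 1) * of a ^ (j + 1) * of b ^ (k + 1) * v))
    (hp : ∀ q, p ≠ of a ^ (i + 1) * of b ^ (B + 1) * of a ^ (j + 1) * of b ^ (k + 1) * q) :
    p = 1 := by
  have hb (i : ℕ) : a ∉ of b ^ i := notMem_pow (by simpa [mem_of] using hba.symm) i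
  simp only [pow_succ' (of b), mul_assoc] at e hp
  obtain ⟨n, rfl, hn, -, -⟩ | ⟨p, rfl, e₁⟩ := pow_of_mul_eq_mul_pow_of_mul hba hba e
  · obtain rfl : n = 0 := by omega
    rfl
  rw [pow_succ' _ i, mul_assoc (of a)] at e₁
  obtain ⟨p, rfl, e₂⟩ := exists_eq_mul_of_notMem (hb B) e₁
  rw [← mul_assoc (of a), ← pow_succ'] at e₂
  obtain ⟨n, rfl, hn, -, e₃⟩ | ⟨p, rfl, e₃⟩ := pow_of_mul_eq_mul_pow_of_mul hba hba e₂
  · rw [pow_succ', mul_assoc] at e₃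
    refine absurd ⟨by omega, ?_⟩ hik
    obtain ⟨m, hm, -⟩ := pow_of_mul_eq_pow_of_mul hba.symm e₃.symm
    omega
  · rw [pow_succ', mul_assoc] at e₃
    obtain ⟨p, rfl, -⟩ := exists_eq_mul_of_notMem (hb k) e₃
    exact absurd (by simp only) (hp p)

theorem isTerminating_singleRule (i B j k : ℕ) :
    IsTerminating ({((of AB.a) ^ (i + 1) * (of AB.b) ^ (B + 1) * (of AB.a) ^ (j + 1) *
      (of AB.b) ^ (k + 1), of AB.b)} : Set (Word AB × Word AB)) :=
  isTerminating_of_weight (fun _ => 1) (fun _ => 0) (fun _ => le_rfl) fun l r h => by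
    obtain ⟨rfl, rfl⟩ := Prod.mk.inj h
    simp only [wordWeight_mul, wordWeight_pow, wordWeight_of]
    omega

theorem isConfluent_singleRule (hik : ¬ (i ≤ j ∧ k ≤ B)) :
    IsConfluent ({((of AB.a) ^ (i + 1) * (of AB.b) ^ (B + 1) * (of AB.a) ^ (j + 1) *
      (of AB.b) ^ (k + 1), of AB.b)} : Set (Word AB × Word AB)) := by
  refine (isTerminating_singleRule i B j k).isConfluent fun _ _ _ =>
    locally_confluent_of_overlaps fun l₁ r₁ l₂ r₂ h₁ h₂ p t v e hp => ?_
  have hba : AB.b ≠ AB.a := nofun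
  obtain ⟨rfl, rfl⟩ := Prod.mk.inj h₁
  obtain ⟨rfl, rfl⟩ := Prod.mk.inj h₂
  obtain rfl := overlap_eq_one hba hik e hp
  rw [one_mul, mul_right_inj] at e
  subst e
  exact ⟨_, .refl, by rw [one_mul]⟩

end NoOverlap

/-- Every monoid `Mon⟨a,b : a^α b^β a^γ b^δ = b⟩` admits a finite complete rewriting system. -/
theorem stmt0 (α β γ δ : ℕ) (hα : 1 ≤ α) (hβ : 1 ≤ β) (hγ : 1 ≤ γ) (hδ : 1 ≤ δ) :
    ∃ (A : Type) (_ : Fintype A) (a b : A) (R : Set (Word A × Word A)),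
      a ≠ b ∧ R.Finite ∧ IsConfluent R ∧ IsTerminating R ∧
      Nonempty (MonPres R ≃*
        MonPres ({((of AB.a)^α * (of AB.b)^β * (of AB.a)^γ * (of AB.b)^δ, of AB.b)} : Set (Word AB × Word AB))) := by
  obtain ⟨B, rfl⟩ : ∃ B, β = B + 1 := ⟨β - 1, by omega⟩
  obtain ⟨k, rfl⟩ : ∃ k, δ = k + 1 := ⟨δ - 1, by omega⟩
  by_cases hik : α ≤ γ ∧ k ≤ B
  swap
  · obtain ⟨i, rfl⟩ : ∃ i, α = i + 1 := ⟨α - 1, by omega⟩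
    obtain ⟨j, rfl⟩ : ∃ j, γ = j + 1 := ⟨γ - 1, by omega⟩
    exact ⟨AB, inferInstance, .a, .b, _, nofun, Set.finite_singleton _,
      isConfluent_singleRule (by omega), isTerminating_singleRule i B j k, ⟨.refl _⟩⟩
  have hba : ABX.b ≠ ABX.a := nofun
  have hxa : ABX.x ≠ ABX.a := nofun
  have hbx : ABX.b ≠ ABX.x := nofun
  by_cases hd : α ∣ γ
  · obtain ⟨n, rfl⟩ : ∃ n, γ = α * n + α := by
      obtain ⟨_ | n, rfl⟩ := hd
      · omega
      · exact ⟨n, Nat.mul_succ α n⟩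
    rcases k with _ | k
    · have hT := dvdOneRules_isTerminating (n := n) (B := B) hα
      exact ⟨ABX, inferInstance, .a, .b, dvdOneRules .a .b .x α n B, nofun, by simp [dvdOneRules],
        dvdOneRules_isConfluent hα hba hxa hbx hT, hT, dvdOneRules_presEquiv⟩
    · obtain ⟨d, rfl⟩ : ∃ d, B = k + 1 + d := ⟨B - (k + 1), by omega⟩
      have hT := dvdRules_isTerminating (n := n) (k := k + 1) (d := d) hα
      exact ⟨ABX, inferInstance, .a, .b, dvdRules .a .b .x α n (k + 1) d, nofun, by simp [dvdRules],
        dvdRules_isConfluent hα (by omega) hba hxa hbx hT, hT, dvdRules_presEquiv⟩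
  · have hmod : 1 ≤ γ % α := Nat.pos_of_ne_zero fun h => hd (Nat.dvd_of_mod_eq_zero h)
    obtain ⟨s, hs, hα'⟩ : ∃ s, 1 ≤ s ∧ α = γ % α + s :=
      ⟨α - γ % α, by have := Nat.mod_lt γ hα; omega, by have := Nat.mod_lt γ hα; omega⟩
    obtain ⟨r, m, hr, rfl, rfl⟩ : ∃ r m, 1 ≤ r ∧ α = r + s ∧ γ = (r + s) * m + r :=
      ⟨γ % α, γ / α, hmod, hα', by rw [← hα', Nat.div_add_mod]⟩
    have hT := notDvdRules_isTerminating (s := s) (m := m) hr B k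
    exact ⟨ABX, inferInstance, .a, .b, notDvdRules .a .b .x (block .b .x B k) r s m, nofun,
      by simp [notDvdRules],
      notDvdRules_isConfluent hr hs hba hxa hbx (notMem_block hba.symm hxa.symm) hT, hT,
      notDvdRules_presEquiv⟩
end

section
/- Let α, β, γ, δ ≥ 1 be integers such that it is NOT the case that both α ≤ γ and δ ≤ β (i.e., the word a^α b^β a^γ b^δ has no self-overlap). Then the one-rule rewriting system on the alphabet {a,b} with the single rule a^α b^β a^γ b^δ → b is confluent and terminating. -/
open Relation FreeMonoid

/-- A word is unbordered if no nonempty proper suffix of it is also a prefix. -/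
def Unbordered {A : Type} (l : Word A) : Prop :=
  ∀ s t r : Word A, l = s * t → l = t * r → s = 1 ∨ t = 1

theorem FreeMonoid.mul_eq_mul_iff_s1 {A : Type} {x y z w : FreeMonoid A} :
    x * y = z * w ↔
      (∃ s, z = x * s ∧ y = s * w) ∨ ∃ s, x = z * s ∧ w = s * y :=
  List.append_eq_append_iff

theorem FreeMonoid.toList_pow_of {A : Type} (x : A) (n : ℕ) :
    toList (of x ^ n) = List.replicate n x := by
  induction n with
  | zero => rfl
  | succ n ih => rw [pow_succ', toList_mul, ih]; rfl

theorem FreeMonoid.length_pow_of {A : Type} (x : A) (n : ℕ) : length (of x ^ n) = n := by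
  rw [length, toList_pow_of, List.length_replicate]

theorem oneStep_singleton_iff {A : Type} {l r x y : Word A} :
    OneStep {(l, r)} x y ↔ ∃ u v, x = u * l * v ∧ y = u * r * v := by
  simp [OneStep]

/-- Two contractions of an unbordered word, the first starting no later than the second,
either coincide or commute. -/
theorem oneStep_diamond_of_prefix {A : Type} {l : Word A} (hl : Unbordered l) (r : Word A)
    {u s v v' : Word A} (h : l * v = s * (l * v')) :
    u * r * v = u * s * r * v' ∨
      ∃ d, OneStep {(l, r)} (u * r * v) d ∧ OneStep {(l, r)} (u * s * r * v') d := by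
  simp only [oneStep_singleton_iff]
  rcases mul_eq_mul_iff_s1.mp h with ⟨t, rfl, rfl⟩ | ⟨t, ht, hv⟩
  · exact .inr ⟨u * r * t * r * v', ⟨u * r * t, v', by simp only [mul_assoc], rfl⟩,
      ⟨u, t * r * v', by simp only [mul_assoc], by simp only [mul_assoc]⟩⟩
  · rcases mul_eq_mul_iff_s1.mp hv with ⟨p, rfl, rfl⟩ | ⟨p, hp, rfl⟩
    · obtain rfl : s = 1 := by
        have := congrArg length ht
        simp only [length_mul] at this
        exact length_eq_zero.mp (by omega)
      obtain rfl : p = 1 := by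
        have := congrArg length ht
        simp only [length_mul, length_one] at this
        exact length_eq_zero.mp (by omega)
      simp
    · rcases hl s t p ht hp with rfl | rfl
      · obtain rfl : p = 1 := by
          have := congrArg length (ht.symm.trans hp)
          simp only [length_mul, length_one] at this
          exact length_eq_zero.mp (by omega)
        simp
      · obtain rfl : s = l := by simpa using ht.symm
        obtain rfl : p = s := by simpa using hp.symm
        exact .inr ⟨u * r * r * v', ⟨u * r, v', by simp only [mul_assoc], rfl⟩,
          ⟨u, r * v', by simp only [mul_assoc], by simp only [mul_assoc]⟩⟩

theorem isConfluent_singleton_of_unbordered {A : Type} {l : Word A} (hl : Unbordered l)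
    (r : Word A) : IsConfluent {(l, r)} := by
  intro w x y hx hy
  refine church_rosser (fun a b c hb hc => ?_) hx hy
  obtain ⟨u, v, rfl, rfl⟩ := oneStep_singleton_iff.mp hb
  obtain ⟨u', v', h, rfl⟩ := oneStep_singleton_iff.mp hc
  simp only [mul_assoc u l, mul_assoc u' l] at h
  rcases mul_eq_mul_iff_s1.mp h with ⟨s, rfl, hs⟩ | ⟨s, rfl, hs⟩
  · rcases oneStep_diamond_of_prefix hl r (u := u) hs with h | ⟨d, h₁, h₂⟩
    · exact ⟨_, .refl, h ▸ .refl⟩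
    · exact ⟨d, .single h₁, .single h₂⟩
  · rcases oneStep_diamond_of_prefix hl r (u := u') hs with h | ⟨d, h₁, h₂⟩
    · exact ⟨_, .refl, h ▸ .refl⟩
    · exact ⟨d, .single h₂, .single h₁⟩

theorem isTerminating_singleton_of_length_lt {A : Type} {l r : Word A}
    (h : length r < length l) : IsTerminating {(l, r)} := by
  rintro ⟨f, hf⟩
  refine not_strictAnti_of_wellFoundedLT (fun n => length (f n)) (strictAnti_nat_of_succ_lt ?_)
  intro n
  obtain ⟨u, v, hx, hy⟩ := oneStep_singleton_iff.mp (hf n)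
  simp only [hx, hy, length_mul]
  omega

theorem getElem?_toList_fourBlocks {α β γ δ i : ℕ} (hi : i < α + β + γ + δ) :
    (toList ((of AB.a)^α * (of AB.b)^β * (of AB.a)^γ * (of AB.b)^δ))[i]? = some AB.b ↔
      (α ≤ i ∧ i < α + β) ∨ α + β + γ ≤ i := by
  simp only [toList_mul, toList_pow_of, List.getElem?_append, List.getElem?_replicate,
    List.length_append, List.length_replicate]
  split_ifs <;> simp <;> omega

theorem unbordered_of_not_overlap {α β γ δ : ℕ} (hα : 1 ≤ α) (hβ : 1 ≤ β) (hγ : 1 ≤ γ)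
    (hδ : 1 ≤ δ) (hno : ¬ (α ≤ γ ∧ δ ≤ β)) :
    Unbordered ((of AB.a)^α * (of AB.b)^β * (of AB.a)^γ * (of AB.b)^δ) := by
  intro s t r hs ht
  by_contra! hne
  have hs0 : length s ≠ 0 := fun h => hne.1 (length_eq_zero.mp h)
  have ht0 : length t ≠ 0 := fun h => hne.2 (length_eq_zero.mp h)
  have hlen := congrArg length hs
  simp only [length_mul, length_pow_of] at hlen
  have key (i : ℕ) (hi : i < length t) :
      ((α ≤ i ∧ i < α + β) ∨ α + β + γ ≤ i) ↔
        ((α ≤ i + length s ∧ i + length s < α + β) ∨ α + β + γ ≤ i + length s) := by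
    rw [← getElem?_toList_fourBlocks (δ := δ) (by omega),
      ← getElem?_toList_fourBlocks (δ := δ) (by omega)]
    nth_rw 1 [ht]
    rw [hs, toList_mul, toList_mul, List.getElem?_append_left hi,
      List.getElem?_append_right (by simp [length])]
    simp [length]
  generalize length s = k at *
  generalize length t = m at *
  have hfirst := key 0 (by omega)
  have hlast := key (m - 1) (by omega)
  have h₁ := key (α - k)
  have h₂ := key α
  have h₃ := key (α - 1)
  have h₄ := key (α + β)
  omega

/-- If the word `a^α b^β a^γ b^δ` has no self-overlap (i.e. not both `α ≤ γ` and `δ ≤ β`),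
then the one-rule system `a^α b^β a^γ b^δ → b` is confluent and terminating. -/
theorem stmt1 (α β γ δ : ℕ) (hα : 1 ≤ α) (hβ : 1 ≤ β) (hγ : 1 ≤ γ) (hδ : 1 ≤ δ)
    (hno : ¬ (α ≤ γ ∧ δ ≤ β)) :
    IsConfluent ({((of AB.a)^α * (of AB.b)^β * (of AB.a)^γ * (of AB.b)^δ, of AB.b)} : Set (Word AB × Word AB)) ∧
    IsTerminating ({((of AB.a)^α * (of AB.b)^β * (of AB.a)^γ * (of AB.b)^δ, of AB.b)} : Set (Word AB × Word AB)) := by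
  refine ⟨isConfluent_singleton_of_unbordered (unbordered_of_not_overlap hα hβ hγ hδ hno) (of AB.b),
    isTerminating_singleton_of_length_lt ?_⟩
  simp only [length_mul, length_pow_of, length_of]
  omega
end

section
/- Let p, k ≥ 1, q ≥ 0, and 0 ≤ r < p be integers. Then the rewriting system on the alphabet {a,b} with rules: a^p b^{q+1} a^{r+pk} b → b, together with a^p b^{q+1} a^{r+pi} b → b^{q+1} a^{r+p(i+1)} b for each i with 0 ≤ i ≤ k−1, is confluent and terminating, and the monoid it presents (i.e., the quotient of {a,b}* by the congruence generated by these rules viewed as relations) is isomorphic to Mon⟨a,b : a^p b^{q+1} a^{r+pk} b = b⟩. -/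
open Relation FreeMonoid

section Rewriting

variable {A : Type} {R : Set (Word A × Word A)} {x y z : Word A}

lemma OneStep.of_mem {l r : Word A} (h : (l, r) ∈ R) (u v : Word A) :
    OneStep R (u * l * v) (u * r * v) :=
  ⟨u, v, l, r, h, rfl, rfl⟩

lemma OneStep.mul_left (u : Word A) (h : OneStep R x y) : OneStep R (u * x) (u * y) := by
  obtain ⟨u', v, l, r, hlr, rfl, rfl⟩ := h
  exact ⟨u * u', v, l, r, hlr, by simp only [mul_assoc], by simp only [mul_assoc]⟩

lemma OneStep.mul_right (v : Word A) (h : OneStep R x y) : OneStep R (x * v) (y * v) := by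
  obtain ⟨u, v', l, r, hlr, rfl, rfl⟩ := h
  exact ⟨u, v' * v, l, r, hlr, by simp only [mul_assoc], by simp only [mul_assoc]⟩

lemma reflTransGen_oneStep_mul_left (u : Word A) (h : ReflTransGen (OneStep R) x y) :
    ReflTransGen (OneStep R) (u * x) (u * y) :=
  h.lift (u * ·) fun _ _ => OneStep.mul_left u

lemma reflTransGen_oneStep_mul_right (v : Word A) (h : ReflTransGen (OneStep R) x y) :
    ReflTransGen (OneStep R) (x * v) (y * v) :=
  h.lift (· * v) fun _ _ => OneStep.mul_right v

/-- A system whose one-step rewriting relation decreases a natural-number valued weight is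
terminating. -/
lemma isTerminating_of_weight_s2 (wt : Word A → ℕ) (h : ∀ x y, OneStep R x y → wt y < wt x) :
    IsTerminating R := by
  rintro ⟨f, hf⟩
  have : ∀ n, wt (f n) + n ≤ wt (f 0) := by
    intro n
    induction n with
    | zero => simp
    | succ n ih => have := h _ _ (hf n); omega
  have := this (wt (f 0) + 1)
  omega

/-- Newman's lemma, with termination witnessed by a decreasing weight. -/
lemma isConfluent_of_weight (wt : Word A → ℕ) (h : ∀ x y, OneStep R x y → wt y < wt x)
    (hloc : ∀ w x y, OneStep R w x → OneStep R w y → Join (ReflTransGen (OneStep R)) x y) :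
    IsConfluent R := by
  intro w
  induction hn : wt w using Nat.strong_induction_on generalizing w with
  | _ n ih =>
  subst hn
  intro x y hx hy
  rcases hx.cases_head with rfl | ⟨x₁, hx₁, hx⟩
  · exact ⟨y, hy, .refl⟩
  rcases hy.cases_head with rfl | ⟨y₁, hy₁, hy⟩
  · exact ⟨x, .refl, .head hx₁ hx⟩
  obtain ⟨z, hxz, hyz⟩ := hloc _ _ _ hx₁ hy₁
  obtain ⟨s, hs, hzs⟩ := ih _ (h _ _ hx₁) x₁ rfl x z hx hxz
  obtain ⟨t, ht, hyt⟩ := ih _ (h _ _ hy₁) y₁ rfl s y (hyz.trans hzs) hy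
  exact ⟨t, hs.trans ht, hyt⟩

/-- Local confluence need only be checked for pairs of rules of which one is applied at the very
left end of the word. -/
lemma join_of_join_rules
    (h : ∀ l r l' r', (l, r) ∈ R → (l', r') ∈ R → ∀ t v v' : Word A, l * v = t * l' * v' →
      Join (ReflTransGen (OneStep R)) (r * v) (t * r' * v'))
    (w x y : Word A) (hx : OneStep R w x) (hy : OneStep R w y) :
    Join (ReflTransGen (OneStep R)) x y := by
  have key : ∀ u t v v' l r l' r' : Word A, (l, r) ∈ R → (l', r') ∈ R →
      u * l * v = u * t * l' * v' →
      Join (ReflTransGen (OneStep R)) (u * r * v) (u * t * r' * v') := by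
    intro u t v v' l r l' r' hl hl' e
    obtain ⟨z, h₁, h₂⟩ := h l r l' r' hl hl' t v v'
      (mul_left_cancel (a := u) (by simpa only [mul_assoc] using e))
    refine ⟨u * z, ?_, ?_⟩
    · simpa only [mul_assoc] using reflTransGen_oneStep_mul_left u h₁
    · simpa only [mul_assoc] using reflTransGen_oneStep_mul_left u h₂
  obtain ⟨u, v, l, r, hl, rfl, rfl⟩ := hx
  obtain ⟨u', v', l', r', hl', e, rfl⟩ := hy
  have e' : u.toList ++ (l * v).toList = u'.toList ++ (l' * v').toList := by
    have := e
    simp only [mul_assoc] at this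
    exact congrArg FreeMonoid.toList this
  rcases List.append_eq_append_iff.1 e' with ⟨t, ht, -⟩ | ⟨t, ht, -⟩
  · obtain rfl : u' = u * FreeMonoid.ofList t := ht
    exact key u (.ofList t) v v' l r l' r' hl hl' e
  · obtain rfl : u = u' * FreeMonoid.ofList t := ht
    obtain ⟨z, h₁, h₂⟩ := key u' (.ofList t) v' v l' r' l r hl' hl e.symm
    exact ⟨z, h₂, h₁⟩

end Rewriting

lemma of_mul_inj {A : Type} {x y : A} {u v : FreeMonoid A} (h : of x * u = of y * v) :
    x = y ∧ u = v :=
  List.cons_eq_cons.1 h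

lemma of_a_pow_mul_of_b_inj {m n : ℕ} {v v' : Word AB}
    (h : (of AB.a)^m * (of AB.b * v) = (of AB.a)^n * (of AB.b * v')) : m = n ∧ v = v' := by
  induction m generalizing n with
  | zero =>
    cases n with
    | zero => simpa using h
    | succ n =>
      rw [pow_zero, one_mul, pow_succ', mul_assoc] at h
      cases (of_mul_inj h).1
  | succ m ih =>
    cases n with
    | zero =>
      rw [pow_zero, one_mul, pow_succ', mul_assoc] at h
      cases (of_mul_inj h).1
    | succ n =>
      rw [pow_succ', pow_succ', mul_assoc, mul_assoc] at h
      simpa using ih (mul_left_cancel h)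

/-- An occurrence of `a^p b` in `a^m b v` ends either at the first `b` or inside `v`. -/
lemma eq_or_eq_of_a_pow_mul_b_mul {p m : ℕ} (hp : 1 ≤ p) {t v y : Word AB}
    (h : (of AB.a)^m * (of AB.b * v) = t * ((of AB.a)^p * (of AB.b * y))) :
    (∃ n, m = n + p ∧ t = (of AB.a)^n ∧ v = y) ∨
      ∃ t', t = (of AB.a)^m * (of AB.b * t') ∧ v = t' * ((of AB.a)^p * (of AB.b * y)) := by
  induction m generalizing t with
  | zero =>
    cases t using FreeMonoid.casesOn with
    | one =>
      rw [one_mul] at h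
      have := (of_a_pow_mul_of_b_inj h).1
      omega
    | of_mul x t =>
      rw [pow_zero, one_mul, mul_assoc] at h
      obtain ⟨rfl, h'⟩ := of_mul_inj h
      exact .inr ⟨t, by simp, h'⟩
  | succ m ih =>
    cases t using FreeMonoid.casesOn with
    | one =>
      rw [one_mul] at h
      obtain ⟨h₁, h₂⟩ := of_a_pow_mul_of_b_inj h
      exact .inl ⟨0, by omega, by simp, h₂⟩
    | of_mul x t =>
      rw [pow_succ', mul_assoc, mul_assoc] at h
      obtain ⟨rfl, h'⟩ := of_mul_inj h
      rcases ih h' with ⟨n, rfl, rfl, hv⟩ | ⟨t', rfl, hv⟩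
      · exact .inl ⟨n + 1, by omega, by rw [pow_succ'], hv⟩
      · exact .inr ⟨t', by simp only [pow_succ', mul_assoc], hv⟩

/-- An occurrence of a word starting with `a` in `b^n w` starts inside `w`. -/
lemma exists_eq_of_b_pow_mul {n : ℕ} {t w y : Word AB}
    (h : (of AB.b)^n * w = t * (of AB.a * y)) :
    ∃ t', t = (of AB.b)^n * t' ∧ w = t' * (of AB.a * y) := by
  induction n generalizing t with
  | zero => exact ⟨t, by simp, by simpa using h⟩
  | succ n ih =>
    rw [pow_succ', mul_assoc] at h
    cases t using FreeMonoid.casesOn with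
    | one =>
      rw [one_mul] at h
      cases (of_mul_inj h).1
    | of_mul x t =>
      rw [mul_assoc] at h
      obtain ⟨rfl, h'⟩ := of_mul_inj h
      obtain ⟨t', rfl, hw⟩ := ih h'
      exact ⟨t', by simp only [pow_succ', mul_assoc], hw⟩

/-- The left-hand side `a^p b^(q+1) a^m b`. -/
def ruleLhs (p q m : ℕ) : Word AB :=
  (of AB.a)^p * (of AB.b)^(q+1) * (of AB.a)^m * of AB.b

/-- The length-preserving right-hand side `b^(q+1) a^m b`. -/
def ruleRhs (q m : ℕ) : Word AB :=
  (of AB.b)^(q+1) * (of AB.a)^m * of AB.b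

lemma ruleLhs_inj {p q m n : ℕ} (h : ruleLhs p q m = ruleLhs p q n) : m = n := by
  simp only [ruleLhs, mul_assoc] at h
  exact (of_a_pow_mul_of_b_inj (v := 1) (v' := 1)
    (by simpa only [mul_one] using mul_left_cancel (mul_left_cancel h))).1

/-- Two occurrences of left-hand sides coincide, overlap in `a^p b`, or are disjoint. -/
lemma ruleLhs_overlap {p q m n : ℕ} (hp : 1 ≤ p) {t v v' : Word AB}
    (h : ruleLhs p q m * v = t * ruleLhs p q n * v') :
    (t = 1 ∧ m = n ∧ v = v') ∨
    (∃ m', m = m' + p ∧ t = (of AB.a)^p * (of AB.b)^(q+1) * (of AB.a)^m' ∧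
      v = (of AB.b)^q * (of AB.a)^n * of AB.b * v') ∨
    ∃ t', t = ruleLhs p q m * t' ∧ v = t' * ruleLhs p q n * v' := by
  obtain ⟨p, rfl⟩ := Nat.exists_eq_add_of_le' hp
  simp only [ruleLhs, pow_succ' (of AB.b), mul_assoc] at h
  rcases eq_or_eq_of_a_pow_mul_b_mul hp h with ⟨n', h₁, rfl, h₂⟩ | ⟨t, rfl, h'⟩
  · obtain rfl : n' = 0 := by omega
    obtain ⟨h₃, h₄⟩ := of_a_pow_mul_of_b_inj (mul_left_cancel h₂)
    exact .inl ⟨pow_zero _, h₃, h₄⟩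
  right
  rw [pow_succ' (of AB.a) p, mul_assoc] at h'
  obtain ⟨t, rfl, h₁⟩ := exists_eq_of_b_pow_mul h'
  rw [← mul_assoc (of AB.a), ← pow_succ'] at h₁
  rcases eq_or_eq_of_a_pow_mul_b_mul hp h₁ with ⟨n', hm, rfl, h₂⟩ | ⟨t, rfl, h₂⟩
  · exact .inl ⟨n', hm, by simp only [pow_succ' (of AB.b), mul_assoc],
      by simpa only [mul_assoc] using h₂⟩
  · exact .inr ⟨t, by simp only [ruleLhs, pow_succ' (of AB.b), mul_assoc],
      by simpa only [ruleLhs, pow_succ' (of AB.b), mul_assoc] using h₂⟩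

/-- The completed rewriting system. -/
def completedRules (p k q r : ℕ) : Set (Word AB × Word AB) :=
  insert ((of AB.a)^p * (of AB.b)^(q+1) * (of AB.a)^(r+p*k) * of AB.b, of AB.b)
    {pr : Word AB × Word AB | ∃ i < k,
      pr = ((of AB.a)^p * (of AB.b)^(q+1) * (of AB.a)^(r+p*i) * of AB.b,
            (of AB.b)^(q+1) * (of AB.a)^(r+p*(i+1)) * of AB.b)}

section Completed

variable {p k q r : ℕ}

lemma mem_completedRules_last : (ruleLhs p q (r+p*k), of AB.b) ∈ completedRules p k q r :=
  .inl rfl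

lemma mem_completedRules_of_lt {i : ℕ} (hi : i < k) :
    (ruleLhs p q (r+p*i), ruleRhs q (r+p*(i+1))) ∈ completedRules p k q r :=
  .inr ⟨i, hi, rfl⟩

lemma completedRules_cases {l s : Word AB} (h : (l, s) ∈ completedRules p k q r) :
    (l = ruleLhs p q (r+p*k) ∧ s = of AB.b) ∨
      ∃ i < k, l = ruleLhs p q (r+p*i) ∧ s = ruleRhs q (r+p*(i+1)) := by
  rcases h with h | ⟨i, hi, h⟩
  · exact .inl (Prod.ext_iff.1 h)
  · exact .inr ⟨i, hi, Prod.ext_iff.1 h⟩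

/-- The interpretation `a ↦ (n ↦ 2n)`, `b ↦ (n ↦ n + 1)` of words as functions. -/
def interp : Word AB →* Function.End ℕ :=
  FreeMonoid.lift fun
    | AB.a => fun n => 2 * n
    | AB.b => fun n => n + 1

lemma interp_mul_apply (u v : Word AB) (n : ℕ) : interp (u * v) n = interp u (interp v n) := by
  rw [map_mul]; rfl

lemma interp_a (n : ℕ) : interp (of AB.a) n = 2 * n := rfl

lemma interp_b (n : ℕ) : interp (of AB.b) n = n + 1 := rfl

lemma interp_a_pow (m n : ℕ) : interp ((of AB.a)^m) n = 2^m * n := by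
  induction m with
  | zero => rw [pow_zero, map_one]; simp [Function.End.one_def]
  | succ m ih => rw [pow_succ', interp_mul_apply, ih, interp_a]; ring

lemma interp_b_pow (m n : ℕ) : interp ((of AB.b)^m) n = n + m := by
  induction m with
  | zero => rw [pow_zero, map_one]; simp [Function.End.one_def]
  | succ m ih => rw [pow_succ', interp_mul_apply, ih, interp_b]; ring

lemma interp_strictMono (u : Word AB) : StrictMono (interp u) := by
  induction u using FreeMonoid.recOn with
  | one => rw [map_one]; exact strictMono_id
  | of_mul x u hu =>
    intro m n hmn
    have := hu hmn
    rw [interp_mul_apply, interp_mul_apply]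
    cases x
    · rw [interp_a, interp_a]; omega
    · rw [interp_b, interp_b]; omega

lemma interp_lt_of_oneStep (hp : 1 ≤ p) (x y : Word AB)
    (h : OneStep (completedRules p k q r) x y) : interp y 0 < interp x 0 := by
  obtain ⟨u, v, l, s, hl, rfl, rfl⟩ := h
  simp only [mul_assoc, interp_mul_apply]
  apply interp_strictMono
  generalize interp v 0 = n
  have h2 : 2 ≤ 2^p := le_self_pow₀ (by norm_num) (by omega)
  rcases completedRules_cases hl with ⟨rfl, rfl⟩ | ⟨i, -, rfl, rfl⟩
  · simp only [ruleLhs, interp_mul_apply, interp_a_pow, interp_b_pow, interp_b]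
    have h1 : 1 ≤ 2^(r+p*k) := Nat.one_le_two_pow
    nlinarith [Nat.mul_le_mul h1 (le_refl (n+1))]
  · simp only [ruleLhs, ruleRhs, interp_mul_apply, interp_a_pow, interp_b_pow, interp_b]
    rw [show r+p*(i+1) = p + (r+p*i) by ring, pow_add 2 p]
    nlinarith

lemma a_pow_succ {M : Type*} [Monoid M] (a : M) (i : ℕ) :
    a^(r+p*(i+1)) = a^(r+p*i) * a^p := by
  rw [← pow_add]; congr 1; ring

lemma steps_of_mem {l s : Word AB} (h : (l, s) ∈ completedRules p k q r) (u v : Word AB) :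
    ReflTransGen (OneStep (completedRules p k q r)) (u * l * v) (u * s * v) :=
  .single (OneStep.of_mem h u v)

lemma steps_a_pow_mul_ruleRhs (m d j : ℕ) (hd : j + (d + 1) = k) :
    ReflTransGen (OneStep (completedRules p k q r))
      ((of AB.a)^(r+p*(m+(d+1))) * ruleRhs q (r+p*(j+1))) ((of AB.a)^(r+p*m) * of AB.b) := by
  have e (d i : ℕ) : (of AB.a)^(r+p*(m+(d+1))) * ruleRhs q i =
      (of AB.a)^(r+p*(m+d)) * ruleLhs p q i * 1 := by
    rw [← add_assoc m, a_pow_succ]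
    simp only [ruleLhs, ruleRhs, mul_assoc, mul_one]
  rw [e]
  induction d generalizing j with
  | zero =>
    obtain rfl : j + 1 = k := by omega
    simpa using steps_of_mem mem_completedRules_last ((of AB.a)^(r+p*m)) 1
  | succ d ih =>
    refine (steps_of_mem (mem_completedRules_of_lt (by omega)) _ _).trans ?_
    rw [mul_one, e]
    exact ih (j + 1) (by omega)

/-- Each left-hand side determines its right-hand side, which starts with `b` and, multiplied by
`a^(r+pk)` on the left, rewrites to `a^(r+pj) b`. -/
lemma completedRules_rhs {l s : Word AB} (h : (l, s) ∈ completedRules p k q r) :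
    ∃ j ≤ k, l = ruleLhs p q (r+p*j) ∧ (∃ s', s = of AB.b * s') ∧
      ReflTransGen (OneStep (completedRules p k q r)) ((of AB.a)^(r+p*k) * s)
        ((of AB.a)^(r+p*j) * of AB.b) ∧
      ∀ s', (l, s') ∈ completedRules p k q r → 1 ≤ p → s = s' := by
  have inj {i j : ℕ} (hp : 1 ≤ p) (e : ruleLhs p q (r+p*i) = ruleLhs p q (r+p*j)) : i = j :=
    Nat.eq_of_mul_eq_mul_left hp (Nat.add_left_cancel (ruleLhs_inj e))
  rcases completedRules_cases h with ⟨rfl, rfl⟩ | ⟨j, hj, rfl, rfl⟩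
  · refine ⟨k, le_rfl, rfl, ⟨1, by simp⟩, .refl, fun s' hs' hp => ?_⟩
    rcases completedRules_cases hs' with ⟨-, rfl⟩ | ⟨i, hi, e, rfl⟩
    · rfl
    · exact absurd (inj hp e) (by omega)
  · refine ⟨j, hj.le, rfl, ⟨(of AB.b)^q * (of AB.a)^(r+p*(j+1)) * of AB.b,
      by simp only [ruleRhs, pow_succ', mul_assoc]⟩, ?_, fun s' hs' hp => ?_⟩
    · obtain ⟨d, rfl⟩ := Nat.exists_eq_add_of_lt hj
      exact steps_a_pow_mul_ruleRhs j d j rfl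
    · rcases completedRules_cases hs' with ⟨e, rfl⟩ | ⟨i, hi, e, rfl⟩
      · exact absurd (inj hp e) (by omega)
      · rw [inj hp e]

lemma join_completedRules (hp : 1 ≤ p) (hr : r < p) (l s l' s' : Word AB)
    (hl : (l, s) ∈ completedRules p k q r) (hl' : (l', s') ∈ completedRules p k q r)
    (t v v' : Word AB) (h : l * v = t * l' * v') :
    Join (ReflTransGen (OneStep (completedRules p k q r))) (s * v) (t * s' * v') := by
  obtain ⟨i, hi, rfl, -, -, huniq⟩ := completedRules_rhs hl
  obtain ⟨j, hj, rfl, ⟨s'', rfl⟩, habs, -⟩ := completedRules_rhs hl'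
  rcases ruleLhs_overlap hp h with ⟨rfl, hij, rfl⟩ | ⟨m, hm, rfl, rfl⟩ | ⟨t, rfl, rfl⟩
  · rw [← hij] at hl'
    obtain rfl := huniq _ hl' hp
    exact ⟨_, .refl, by rw [one_mul]⟩
  · obtain _ | i := i
    · omega
    obtain rfl : m = r + p * i := by rw [mul_add] at hm; omega
    have h₁ : ReflTransGen (OneStep (completedRules p k q r))
        ((of AB.a)^p * (of AB.b)^(q+1) * (of AB.a)^(r+p*i) * (of AB.b * s'') * v')
        ((of AB.b)^(q+1) * (of AB.a)^(r+p*(i+1)) * (of AB.b * s'') * v') := by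
      simpa only [ruleLhs, ruleRhs, mul_assoc, one_mul] using
        steps_of_mem (mem_completedRules_of_lt (p := p) (q := q) (r := r) hi) 1 (s'' * v')
    rcases completedRules_cases hl with ⟨e, rfl⟩ | ⟨i', hi', e, rfl⟩
    · obtain rfl : i + 1 = k :=
        Nat.eq_of_mul_eq_mul_left hp (Nat.add_left_cancel (ruleLhs_inj e))
      refine ⟨_, .refl, h₁.trans ?_⟩
      simpa only [pow_succ' (of AB.b), mul_assoc] using
        reflTransGen_oneStep_mul_left ((of AB.b)^(q+1)) (reflTransGen_oneStep_mul_right v' habs)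
    · obtain rfl : i + 1 = i' :=
        Nat.eq_of_mul_eq_mul_left hp (Nat.add_left_cancel (ruleLhs_inj e))
      refine ⟨_, ?_, h₁⟩
      rw [ruleRhs, a_pow_succ _ (i + 1)]
      simpa only [ruleLhs, pow_succ' (of AB.b), mul_assoc] using
        steps_of_mem hl' ((of AB.b)^(q+1) * (of AB.a)^(r+p*(i+1))) v'
  · refine ⟨s * t * (of AB.b * s'') * v', ?_, ?_⟩
    · simpa only [mul_assoc] using steps_of_mem hl' (s * t) v'
    · simpa only [mul_assoc, one_mul] using steps_of_mem hl 1 (t * (of AB.b * s'') * v')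

end Completed

/-- In any monoid, the defining relation implies the relations added by completion. -/
lemma completed_relation {M : Type*} [Monoid M] {a b : M} {p k q r : ℕ}
    (h : a^p * b^(q+1) * a^(r+p*k) * b = b) {i : ℕ} (hi : i < k) :
    a^p * b^(q+1) * a^(r+p*i) * b = b^(q+1) * a^(r+p*(i+1)) * b := by
  have absorb (i : ℕ) : a^(r+p*(i+1)) * b * (b^q * a^(r+p*k) * b) = a^(r+p*i) * b := by
    rw [← congrArg (a^(r+p*i) * ·) h]
    simp only [a_pow_succ a i, pow_succ' b, mul_assoc]
  have overlap (i : ℕ) : a^p * b^(q+1) * a^(r+p*i) * b =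
      a^p * b^(q+1) * a^(r+p*(i+1)) * b * (b^q * a^(r+p*k) * b) := by
    rw [mul_assoc _ _ b, ← absorb]
    simp only [mul_assoc]
  obtain ⟨d, hd⟩ := Nat.exists_eq_add_of_lt hi
  induction d generalizing i with
  | zero =>
    obtain rfl : i + 1 = k := hd.symm
    rw [overlap, h]
    simp only [pow_succ' b, mul_assoc]
  | succ d ih =>
    rw [overlap, ih (i := i + 1) (by omega) (by omega)]
    simp only [mul_assoc] at absorb ⊢
    rw [absorb]

lemma conGen_completedRules (p k q r : ℕ) :
    conGen (fun x y : Word AB => (x, y) ∈ completedRules p k q r) =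
      conGen (fun x y : Word AB => (x, y) ∈
        ({((of AB.a)^p * (of AB.b)^(q+1) * (of AB.a)^(r+p*k) * of AB.b, of AB.b)} :
          Set (Word AB × Word AB))) := by
  apply le_antisymm
  · rw [Con.conGen_le]
    intro x y hxy
    rcases hxy with hxy | ⟨i, hi, hxy⟩
    · exact ConGen.Rel.of _ _ hxy
    · obtain ⟨rfl, rfl⟩ := Prod.ext_iff.1 hxy
      set c := conGen (fun x y : Word AB => (x, y) ∈
        ({((of AB.a)^p * (of AB.b)^(q+1) * (of AB.a)^(r+p*k) * of AB.b, of AB.b)} :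
          Set (Word AB × Word AB))) with hc
      have h : c.mk' ((of AB.a)^p * (of AB.b)^(q+1) * (of AB.a)^(r+p*k) * of AB.b) =
          c.mk' (of AB.b) := (Con.eq c).2 (ConGen.Rel.of _ _ rfl)
      apply (Con.eq c).1
      simp only [map_mul, map_pow] at h
      change c.mk' _ = c.mk' _
      simpa only [map_mul, map_pow] using completed_relation h hi
  · exact Con.conGen_mono fun x y hxy => .inl hxy

/-- Case 1 (`s = 1`) of Theorem 3.1: the displayed rewriting system is complete and
presents `Mon⟨a,b : a^p b^(q+1) a^(r+pk) b = b⟩`. -/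
theorem stmt2 (p k q r : ℕ) (hp : 1 ≤ p) (hk : 1 ≤ k) (hr : r < p) :
    IsConfluent (insert ((of AB.a)^p * (of AB.b)^(q+1) * (of AB.a)^(r+p*k) * of AB.b, of AB.b)
      {pr : Word AB × Word AB | ∃ i < k,
        pr = ((of AB.a)^p * (of AB.b)^(q+1) * (of AB.a)^(r+p*i) * of AB.b,
              (of AB.b)^(q+1) * (of AB.a)^(r+p*(i+1)) * of AB.b)}) ∧
    IsTerminating (insert ((of AB.a)^p * (of AB.b)^(q+1) * (of AB.a)^(r+p*k) * of AB.b, of AB.b)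
      {pr : Word AB × Word AB | ∃ i < k,
        pr = ((of AB.a)^p * (of AB.b)^(q+1) * (of AB.a)^(r+p*i) * of AB.b,
              (of AB.b)^(q+1) * (of AB.a)^(r+p*(i+1)) * of AB.b)}) ∧
    Nonempty (MonPres (insert ((of AB.a)^p * (of AB.b)^(q+1) * (of AB.a)^(r+p*k) * of AB.b, of AB.b)
      {pr : Word AB × Word AB | ∃ i < k,
        pr = ((of AB.a)^p * (of AB.b)^(q+1) * (of AB.a)^(r+p*i) * of AB.b,
              (of AB.b)^(q+1) * (of AB.a)^(r+p*(i+1)) * of AB.b)}) ≃*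
      MonPres ({((of AB.a)^p * (of AB.b)^(q+1) * (of AB.a)^(r+p*k) * of AB.b, of AB.b)} :
        Set (Word AB × Word AB))) := by
  exact ⟨isConfluent_of_weight (interp · 0) (interp_lt_of_oneStep hp)
      (join_of_join_rules (join_completedRules hp hr)),
    isTerminating_of_weight_s2 (interp · 0) (interp_lt_of_oneStep hp),
    ⟨Con.congr (MulEquiv.refl _) (conGen_completedRules p k q r)⟩⟩
end
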